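/- Let μ ∈ P be an integral weight, m ∈ ℤ_{≥1}, and π ∈ B(mμ) an LS path of shape mμ. For 1 ≤ k ≤ m define π_k(t) := π(t/m + (k−1)/m) − π((k−1)/m) for t ∈ [0,1]. Then π_k ∈ B(μ) for every 1 ≤ k ≤ m and π = π₁ * π₂ * ⋯ * π_m. Consequently B(mμ) is contained in B(μ)^{*m} and is a subcrystal of B(μ)^{*m}. -/

import Mathlib

open scoped Classical
noncomputable section

namespace LSPaper

/-- The clamp of a real number to the interval `[0,1]`; paths `[0,1] → V` are
encoded as functions `ℝ → V` that factor through this clamp. -/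
def clamp01 (t : ℝ) : ℝ := max 0 (min 1 t)

variable {V : Type*} [AddCommGroup V] [Module ℝ V]

/-- The straight-line path `π_ν(t) = t ν` (clamped outside `[0,1]`). -/
def straight (ν : V) : ℝ → V := fun t => clamp01 t • ν

/-- The dilation `(mπ)(t) = m • π(t)`. -/
def dilate (m : ℕ) (f : ℝ → V) : ℝ → V := fun t => (m : ℝ) • f t

/-- The concatenation `π_1 * ⋯ * π_m` of a list of paths:
`(π_1 * ⋯ * π_m)(t) = Σ_{l<k} π_l(1) + π_k(mt - k + 1)` for
`(k-1)/m ≤ t ≤ k/m`. -/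
def concatList (l : List (ℝ → V)) : ℝ → V := fun t =>
  let m := l.length
  let k : ℕ := max 1 (min m (⌈(m : ℝ) * t⌉.toNat))
  (((l.take (k - 1)).map fun f => f 1).sum) +
    (l.getD (k - 1) 0) ((m : ℝ) * t - ((k : ℝ) - 1))

/-- Subdivision of a path into `m` pieces:
`π_k(t) = π(t/m + (k-1)/m) - π((k-1)/m)` (here `k` runs over `0, …, m-1`). -/
def subdiv (m : ℕ) (f : ℝ → V) : List (ℝ → V) :=
  List.ofFn fun k : Fin m => fun t : ℝ =>
    f ((clamp01 t + (k : ℝ)) / m) - f ((k : ℝ) / m)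

/-- The map `Σ_m : B(μ) → B(μ)^{⊗m}` (tensor factors encoded as a list):
dilate by `m`, then subdivide into `m` pieces. -/
def SigmaMap (m : ℕ) (f : ℝ → V) : List (ℝ → V) := subdiv m (dilate m f)

/-- The weight of a tensor product (encoded as a list of paths): the sum of
the weights of the factors. -/
def tensWt (l : List (ℝ → V)) : V := (l.map fun f => f 1).sum

/-- A symmetrizable generalized Cartan matrix together with a realization:
an integral weight lattice `P` inside a real vector space `V`, linearly
independent simple roots `α i ∈ P` and simple coroots (as linear functionals)
with `⟨α j, α i∨⟩ = a i j`, taking integer values on `P`. -/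
structure KacMoodyData (I : Type*) (V : Type*) [Fintype I] [DecidableEq I]
    [AddCommGroup V] [Module ℝ V] where
  a : I → I → ℤ
  d : I → ℤ
  P : AddSubgroup V
  α : I → V
  coroot : I → V →ₗ[ℝ] ℝ
  diag : ∀ i, a i i = 2
  offDiag : ∀ i j, i ≠ j → a i j ≤ 0
  zeroIff : ∀ i j, a i j = 0 ↔ a j i = 0
  dPos : ∀ i, 0 < d i
  symmetrizable : ∀ i j, d i * a i j = d j * a j i
  cartanPairing : ∀ i j, coroot i (α j) = (a i j : ℝ)
  rootsIndep : LinearIndependent ℝ α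
  corootsIndep : LinearIndependent ℝ coroot
  rootMem : ∀ i, α i ∈ P
  pairingInt : ∀ i, ∀ v ∈ P, ∃ n : ℤ, coroot i v = (n : ℝ)
  latticeFree : ∃ n : ℕ, Nonempty (P ≃+ (Fin n → ℤ))

namespace KacMoodyData

variable {I : Type*} [Fintype I] [DecidableEq I]
variable (K : KacMoodyData I V)

/-- The simple reflection `r_i(x) = x - ⟨x, α_i∨⟩ α_i` as a linear map. -/
def reflMap (i : I) : V →ₗ[ℝ] V := LinearMap.id - (K.coroot i).smulRight (K.α i)

lemma reflMap_invol (i : I) : Function.Involutive (K.reflMap i) := by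
  intro x
  have h2 : K.coroot i (K.α i) = 2 := by
    have h := K.cartanPairing i i
    rw [K.diag i] at h
    simpa using h
  simp only [reflMap, LinearMap.sub_apply, LinearMap.id_apply, LinearMap.smulRight_apply,
    map_sub, map_smul, smul_eq_mul, h2]
  module

/-- The simple reflection `r_i` as a linear automorphism of `V`. -/
def refl (i : I) : V ≃ₗ[ℝ] V :=
  { K.reflMap i with
    invFun := K.reflMap i
    left_inv := K.reflMap_invol i
    right_inv := K.reflMap_invol i }

/-- The Weyl group `W`, generated by the simple reflections. -/
def weylGroup : Subgroup (V ≃ₗ[ℝ] V) := Subgroup.closure (Set.range K.refl)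

/-- The Weyl group orbit `W μ` of an integral weight. -/
def orbit (μ : V) : Set V := {ν | ∃ w ∈ K.weylGroup, ν = w μ}

/-- `Q_+ = Σ_i ℤ_{≥0} α_i`. -/
def Qplus : Set V := {v | ∃ c : I → ℕ, v = ∑ i, (c i : ℝ) • K.α i}

/-- One step of the order on a Weyl group orbit:  `ν' = r_β(ν)` for a positive
real root `β = w α_i ∈ Q_+` (with `β∨ = w α_i∨`, `r_β = w r_i w⁻¹`) such that
`⟨ν, β∨⟩ < 0`. -/
def StepDown (ν ν' : V) : Prop :=
  ∃ w ∈ K.weylGroup, ∃ i : I, w (K.α i) ∈ K.Qplus ∧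
    K.coroot i (w.symm ν) < 0 ∧ ν' = w (K.refl i (w.symm ν))

/-- There is a chain `ν = ξ_0, ξ_1, …, ξ_p = ν'` of steps down. -/
def chainLen (p : ℕ) (ν ν' : V) : Prop :=
  ∃ ξ : ℕ → V, ξ 0 = ν ∧ ξ p = ν' ∧ ∀ q < p, K.StepDown (ξ q) (ξ (q + 1))

/-- `dist(ν, ν')`: the maximal length of a chain from `ν` down to `ν'`. -/
def dist (ν ν' : V) : ℕ := sSup {p | K.chainLen p ν ν'}

/-- A `σ`-chain for `(ν, ν')`: a sequence `ν = ξ_0 > ξ_1 > ⋯ > ξ_p = ν'` with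
`dist(ξ_{q-1}, ξ_q) = 1` and `σ ⟨ξ_{q-1}, β_q∨⟩ ∈ ℤ_{<0}`, where `β_q` is the
positive real root with `ξ_q = r_{β_q} ξ_{q-1}`. -/
def SigmaChain (σ : ℚ) (ν ν' : V) : Prop :=
  ∃ p : ℕ, 0 < p ∧ ∃ ξ : ℕ → V, ξ 0 = ν ∧ ξ p = ν' ∧
    ∀ q < p, K.dist (ξ q) (ξ (q + 1)) = 1 ∧
      ∃ w ∈ K.weylGroup, ∃ i : I, w (K.α i) ∈ K.Qplus ∧
        ξ (q + 1) = w (K.refl i (w.symm (ξ q))) ∧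
        ∃ n : ℤ, n < 0 ∧ (σ : ℝ) * K.coroot i (w.symm (ξ q)) = (n : ℝ)

/-- The combinatorial datum of a Lakshmibai–Seshadri path of shape `μ`:
a strictly decreasing sequence `ν_1 > ν_2 > ⋯ > ν_s` in `W μ` together with
rationals `0 = σ_0 < σ_1 < ⋯ < σ_s = 1` admitting `σ_u`-chains (the `ν`'s are
indexed here by `Fin s`, i.e. `0, …, s-1`). -/
structure LSData (K : KacMoodyData I V) (μ : V) where
  s : ℕ
  spos : 0 < s
  ν : Fin s → V
  τ : Fin (s + 1) → ℚ
  mem : ∀ u, ν u ∈ K.orbit μ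
  strictDec : ∀ (u : ℕ) (h : u + 1 < s),
    Relation.TransGen K.StepDown (ν ⟨u, Nat.lt_of_succ_lt h⟩) (ν ⟨u + 1, h⟩)
  τ_zero : τ 0 = 0
  τ_last : τ (Fin.last s) = 1
  τ_mono : StrictMono τ
  chainCond : ∀ (u : ℕ) (h : u + 1 < s),
    K.SigmaChain (τ ⟨u + 1, Nat.lt_succ_of_lt h⟩) (ν ⟨u, Nat.lt_of_succ_lt h⟩) (ν ⟨u + 1, h⟩)

/-- The piecewise-linear path `[0,1] → ℝ ⊗ P` associated with an LS datum:
`π(t) = Σ_{k<u} (σ_k - σ_{k-1}) ν_k + (t - σ_{u-1}) ν_u` for `σ_{u-1} ≤ t ≤ σ_u`,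
encoded as the function `ℝ → V`, `t ↦ Σ_k (min t σ_{k+1} - min t σ_k) • ν_k`
(which is constant for `t ≤ 0` and `t ≥ 1`). -/
def LSData.path {K : KacMoodyData I V} {μ : V} (π : K.LSData μ) : ℝ → V := fun t =>
  ∑ k : Fin π.s,
    ((min t ((π.τ k.succ : ℚ) : ℝ)) - (min t ((π.τ k.castSucc : ℚ) : ℝ))) • π.ν k

/-- `B(μ)`: the set of Lakshmibai–Seshadri paths of shape `μ`. -/
def B (μ : V) : Set (ℝ → V) := {f | ∃ π : K.LSData μ, f = π.path}

/-- `H_i^π(t) = ⟨π(t), α_i∨⟩`. -/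
def H (i : I) (f : ℝ → V) : ℝ → ℝ := fun t => K.coroot i (f t)

/-- `m_i^π = min {H_i^π(t) : t ∈ [0,1]}`. -/
def mval (i : I) (f : ℝ → V) : ℝ := sInf (K.H i f '' Set.Icc 0 1)

/-- The raising root operator `ẽ_i` (the underlying path, before testing
whether it is defined): with `t_1 = min {t : H_i^π(t) = m_i^π}` and
`t_0 = max {t ≤ t_1 : H_i^π(t) = m_i^π + 1}`, the new path is `π(t)` for
`t ≤ t_0`, `r_i(π(t) - π(t_0)) + π(t_0)` for `t_0 ≤ t ≤ t_1` and `π(t) + α_i`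
for `t ≥ t_1`. -/
def eraw (i : I) (f : ℝ → V) : ℝ → V := fun t =>
  let m := K.mval i f
  let t1 := sInf {t | t ∈ Set.Icc (0 : ℝ) 1 ∧ K.H i f t = m}
  let t0 := sSup {t | t ∈ Set.Icc (0 : ℝ) t1 ∧ K.H i f t = m + 1}
  if t ≤ t0 then f t
  else if t ≤ t1 then K.refl i (f t - f t0) + f t0
  else f t + K.α i

/-- The lowering root operator `f̃_i` (the underlying path): with
`t_0 = max {t : H_i^π(t) = m_i^π}` and `t_1 = min {t ≥ t_0 : H_i^π(t) = m_i^π + 1}`,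
the new path is `π(t)` for `t ≤ t_0`, `r_i(π(t) - π(t_0)) + π(t_0)` for
`t_0 ≤ t ≤ t_1` and `π(t) - α_i` for `t ≥ t_1`. -/
def fraw (i : I) (f : ℝ → V) : ℝ → V := fun t =>
  let m := K.mval i f
  let t0 := sSup {t | t ∈ Set.Icc (0 : ℝ) 1 ∧ K.H i f t = m}
  let t1 := sInf {t | t ∈ Set.Icc t0 1 ∧ K.H i f t = m + 1}
  if t ≤ t0 then f t
  else if t ≤ t1 then K.refl i (f t - f t0) + f t0
  else f t - K.α i

/-- The root operator `ẽ_i`, with value `none` (the formal element `0`) when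
`m_i^π = 0`. -/
def eop (i : I) (f : ℝ → V) : Option (ℝ → V) :=
  if K.mval i f = 0 then none else some (K.eraw i f)

/-- The root operator `f̃_i`, with value `none` (the formal element `0`) when
`H_i^π(1) - m_i^π = 0`. -/
def fop (i : I) (f : ℝ → V) : Option (ℝ → V) :=
  if K.H i f 1 - K.mval i f = 0 then none else some (K.fraw i f)

/-- `ẽ_i^n π` (with `ẽ_i 0 = 0`). -/
def eIter (i : I) (n : ℕ) (f : ℝ → V) : Option (ℝ → V) :=
  (fun o => o.bind (K.eop i))^[n] (some f)

/-- `f̃_i^n π` (with `f̃_i 0 = 0`). -/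
def fIter (i : I) (n : ℕ) (f : ℝ → V) : Option (ℝ → V) :=
  (fun o => o.bind (K.fop i))^[n] (some f)

/-- `ε_i(π) = max {n ≥ 0 : ẽ_i^n π ≠ 0}`. -/
def epsilon (i : I) (f : ℝ → V) : ℕ := sSup {n | K.eIter i n f ≠ none}

/-- `φ_i(π) = max {n ≥ 0 : f̃_i^n π ≠ 0}`. -/
def phi (i : I) (f : ℝ → V) : ℕ := sSup {n | K.fIter i n f ≠ none}

/-- The Weyl group action on a normal crystal:
`S_i b = f̃_i^{⟨wt b, α_i∨⟩} b` if `⟨wt b, α_i∨⟩ ≥ 0` and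
`S_i b = ẽ_i^{-⟨wt b, α_i∨⟩} b` if `⟨wt b, α_i∨⟩ ≤ 0`. -/
def Sop (i : I) (f : ℝ → V) : Option (ℝ → V) :=
  if 0 ≤ K.coroot i (f 1) then K.fIter i (⌊K.coroot i (f 1)⌋.toNat) f
  else K.eIter i ((-⌊K.coroot i (f 1)⌋).toNat) f

/-- `SWord K [i₁, …, i_k] b = S_{i₁} S_{i₂} ⋯ S_{i_k} b`. -/
def SWord (K : KacMoodyData I V) : List I → Option (ℝ → V) → Option (ℝ → V)
  | [], o => o
  | i :: rest, o => (SWord K rest o).bind (K.Sop i)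

/-- `b` is extremal: for each `w ∈ W` (as a word in simple reflections) and
`i ∈ I`, `ẽ_i (S_w b) = 0` if `⟨wt (S_w b), α_i∨⟩ ≥ 0` and `f̃_i (S_w b) = 0`
if `⟨wt (S_w b), α_i∨⟩ ≤ 0`. -/
def Extremal (f : ℝ → V) : Prop :=
  ∀ (l : List I) (g : ℝ → V), K.SWord l (some f) = some g →
    ∀ i : I, (0 ≤ K.coroot i (g 1) → K.eop i g = none) ∧
      (K.coroot i (g 1) ≤ 0 → K.fop i g = none)

/-- Application of a word in the Kashiwara operators (`true` stands for `ẽ`,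
`false` for `f̃`), leftmost entry applied first. -/
def applyWord (K : KacMoodyData I V) :
    List (I × Bool) → Option (ℝ → V) → Option (ℝ → V)
  | [], o => o
  | p :: rest, o =>
      applyWord K rest (o.bind fun f => if p.2 then K.eop p.1 f else K.fop p.1 f)

/-- `B(μ)^{*m}`: the set of `m`-fold concatenations of LS paths of shape `μ`. -/
def ConcatSet (μ : V) (m : ℕ) : Set (ℝ → V) :=
  {g | ∃ l : List (ℝ → V), l.length = m ∧ (∀ f ∈ l, f ∈ K.B μ) ∧ g = concatList l}

/-- `ε_i` of a tensor product (encoded as a list of paths, Kashiwara's rule):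
`ε_i(b₁ ⊗ b₂) = max (ε_i b₁) (ε_i b₂ - ⟨wt b₁, α_i∨⟩)`. -/
def tensEps (K : KacMoodyData I V) (i : I) : List (ℝ → V) → ℤ
  | [] => 0
  | [b] => (K.epsilon i b : ℤ)
  | b :: c :: rest =>
      max ((K.epsilon i b : ℤ)) (tensEps K i (c :: rest) - ⌊K.coroot i (b 1)⌋)

/-- `φ_i` of a tensor product (Kashiwara's rule):
`φ_i(b₁ ⊗ b₂) = max (φ_i b₂) (φ_i b₁ + ⟨wt b₂, α_i∨⟩)`. -/
def tensPhi (K : KacMoodyData I V) (i : I) : List (ℝ → V) → ℤ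
  | [] => 0
  | [b] => (K.phi i b : ℤ)
  | b :: c :: rest =>
      max (tensPhi K i (c :: rest)) ((K.phi i b : ℤ) + ⌊K.coroot i (tensWt (c :: rest))⌋)

/-- `ẽ_i` on a tensor product (Kashiwara's rule):
`ẽ_i(b₁ ⊗ b₂) = (ẽ_i b₁) ⊗ b₂` if `φ_i(b₁) ≥ ε_i(b₂)`, else `b₁ ⊗ (ẽ_i b₂)`. -/
def tensE (K : KacMoodyData I V) (i : I) : List (ℝ → V) → Option (List (ℝ → V))
  | [] => none
  | [b] => (K.eop i b).map fun b' => [b']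
  | b :: c :: rest =>
      if K.tensEps i (c :: rest) ≤ (K.phi i b : ℤ) then
        (K.eop i b).map fun b' => b' :: c :: rest
      else (tensE K i (c :: rest)).map fun r' => b :: r'

/-- `f̃_i` on a tensor product (Kashiwara's rule):
`f̃_i(b₁ ⊗ b₂) = (f̃_i b₁) ⊗ b₂` if `φ_i(b₁) > ε_i(b₂)`, else `b₁ ⊗ (f̃_i b₂)`. -/
def tensF (K : KacMoodyData I V) (i : I) : List (ℝ → V) → Option (List (ℝ → V))
  | [] => none
  | [b] => (K.fop i b).map fun b' => [b']
  | b :: c :: rest =>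
      if K.tensEps i (c :: rest) < (K.phi i b : ℤ) then
        (K.fop i b).map fun b' => b' :: c :: rest
      else (tensF K i (c :: rest)).map fun r' => b :: r'

/-- `ẽ_i^n` on tensor products. -/
def tensEIter (i : I) (n : ℕ) (l : List (ℝ → V)) : Option (List (ℝ → V)) :=
  (fun o => o.bind (K.tensE i))^[n] (some l)

/-- `f̃_i^n` on tensor products. -/
def tensFIter (i : I) (n : ℕ) (l : List (ℝ → V)) : Option (List (ℝ → V)) :=
  (fun o => o.bind (K.tensF i))^[n] (some l)

end KacMoodyData

end LSPaper

namespace LSPaper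

namespace KacMoodyData

variable {I V : Type*} [Fintype I] [DecidableEq I] [AddCommGroup V] [Module ℝ V]
variable (K : KacMoodyData I V)

/-! ### Weyl group and roots -/

lemma refl_apply (i : I) (x : V) : K.refl i x = x - K.coroot i x • K.α i := rfl

lemma refl_refl (i : I) (x : V) : K.refl i (K.refl i x) = x := K.reflMap_invol i x

lemma refl_mul_self (i : I) : K.refl i * K.refl i = 1 := by
  ext x
  exact K.refl_refl i x

lemma coroot_α_self (i : I) : K.coroot i (K.α i) = 2 := by
  rw [K.cartanPairing, K.diag]
  norm_num

lemma coroot_refl_self (i : I) (x : V) : K.coroot i (K.refl i x) = -K.coroot i x := by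
  rw [refl_apply, map_sub, map_smul, coroot_α_self, smul_eq_mul]
  ring

lemma refl_eq_self {i : I} {x : V} (h : K.coroot i x = 0) : K.refl i x = x := by
  rw [refl_apply, h, zero_smul, sub_zero]

lemma refl_α_self (i : I) : K.refl i (K.α i) = -K.α i := by
  rw [refl_apply, coroot_α_self]
  module

lemma refl_mem (i : I) : K.refl i ∈ K.weylGroup := Subgroup.subset_closure ⟨i, rfl⟩

lemma exists_word {w : V ≃ₗ[ℝ] V} (hw : w ∈ K.weylGroup) :
    ∃ l : List I, (l.map K.refl).prod = w := by
  induction hw using Subgroup.closure_induction_left with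
  | one => exact ⟨[], rfl⟩
  | mul_left x hx y _ ih =>
    obtain ⟨i, rfl⟩ := hx
    obtain ⟨l, rfl⟩ := ih
    exact ⟨i :: l, by simp⟩
  | inv_mul_cancel x hx y _ ih =>
    obtain ⟨i, rfl⟩ := hx
    obtain ⟨l, rfl⟩ := ih
    exact ⟨i :: l, by rw [← eq_inv_of_mul_eq_one_left (K.refl_mul_self i)]; rfl⟩

lemma weyl_induction {p : (V ≃ₗ[ℝ] V) → Prop} (one : p 1)
    (mul : ∀ i w, w ∈ K.weylGroup → p w → p (K.refl i * w))
    {w : V ≃ₗ[ℝ] V} (hw : w ∈ K.weylGroup) : p w := by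
  obtain ⟨l, rfl⟩ := K.exists_word hw
  clear hw
  suffices h : (l.map K.refl).prod ∈ K.weylGroup ∧ p (l.map K.refl).prod from h.2
  induction l with
  | nil => exact ⟨K.weylGroup.one_mem, one⟩
  | cons i l ih =>
    rw [List.map_cons, List.prod_cons]
    exact ⟨K.weylGroup.mul_mem (K.refl_mem i) ih.1, mul i _ ih.1 ih.2⟩

lemma refl_mem_P (i : I) {x : V} (hx : x ∈ K.P) : K.refl i x ∈ K.P := by
  obtain ⟨n, hn⟩ := K.pairingInt i x hx
  rw [refl_apply, hn, Int.cast_smul_eq_zsmul]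
  exact K.P.sub_mem hx (K.P.zsmul_mem (K.rootMem i) n)

lemma weyl_mem_P {w : V ≃ₗ[ℝ] V} (hw : w ∈ K.weylGroup) {x : V} (hx : x ∈ K.P) :
    w x ∈ K.P := by
  exact K.weyl_induction (p := fun w => w x ∈ K.P) hx (fun i w _ ih => K.refl_mem_P i ih) hw

lemma symm_mem {w : V ≃ₗ[ℝ] V} (hw : w ∈ K.weylGroup) : w.symm ∈ K.weylGroup :=
  K.weylGroup.inv_mem hw

lemma orbit_subset_P {μ : V} (hμ : μ ∈ K.P) {ν : V} (hν : ν ∈ K.orbit μ) : ν ∈ K.P := by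
  obtain ⟨w, hw, rfl⟩ := hν
  exact K.weyl_mem_P hw hμ

lemma weyl_mem_orbit {μ ν : V} {w : V ≃ₗ[ℝ] V} (hw : w ∈ K.weylGroup) (hν : ν ∈ K.orbit μ) :
    w ν ∈ K.orbit μ := by
  obtain ⟨v, hv, rfl⟩ := hν
  exact ⟨w * v, K.weylGroup.mul_mem hw hv, rfl⟩

lemma refl_mem_orbit {μ ν : V} (i : I) (hν : ν ∈ K.orbit μ) : K.refl i ν ∈ K.orbit μ :=
  K.weyl_mem_orbit (K.refl_mem i) hν

lemma smul_mem_orbit {μ ν : V} (c : ℝ) (hν : ν ∈ K.orbit μ) : c • ν ∈ K.orbit (c • μ) := by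
  obtain ⟨w, hw, rfl⟩ := hν
  exact ⟨w, hw, (map_smul w c μ).symm⟩

/-- The reflection in the root `w α_i`. -/
lemma conj_refl_apply (w : V ≃ₗ[ℝ] V) (i : I) (x : V) :
    w (K.refl i (w.symm x)) = x - K.coroot i (w.symm x) • w (K.α i) := by
  rw [refl_apply, map_sub, map_smul, LinearEquiv.apply_symm_apply]

lemma conj_refl_mem_orbit {μ ν : V} {w : V ≃ₗ[ℝ] V} (hw : w ∈ K.weylGroup) (i : I)
    (hν : ν ∈ K.orbit μ) : w (K.refl i (w.symm ν)) ∈ K.orbit μ :=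
  K.weyl_mem_orbit hw (K.refl_mem_orbit i (K.weyl_mem_orbit (K.symm_mem hw) hν))

lemma weyl_α_ne_zero (w : V ≃ₗ[ℝ] V) (i : I) : w (K.α i) ≠ 0 := by
  intro h
  have h2 := K.coroot_α_self i
  rw [(LinearEquiv.map_eq_zero_iff w).1 h, map_zero] at h2
  norm_num at h2

lemma coeff_unique {b c : I → ℝ} (h : ∑ i, b i • K.α i = ∑ i, c i • K.α i) : b = c := by
  have h0 : ∑ i, (b i - c i) • K.α i = 0 := by
    simp only [sub_smul, Finset.sum_sub_distrib, h, sub_self]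
  funext i
  exact sub_eq_zero.1 (Fintype.linearIndependent_iff.1 K.rootsIndep _ h0 i)

lemma sum_single_smul (c : ℝ) (j : I) :
    ∑ k, (if k = j then c else 0) • K.α k = c • K.α j := by
  simp [ite_smul]

lemma sum_update_smul (b : I → ℝ) (j : I) (x : ℝ) :
    ∑ k, (b k - if k = j then x else 0) • K.α k = ∑ k, b k • K.α k - x • K.α j := by
  simp only [sub_smul, Finset.sum_sub_distrib, K.sum_single_smul]

/-- The symmetrized pairing `x ↦ ∑ b_k d_k ⟨x, α_k∨⟩` is Weyl group equivariant. -/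
lemma exists_coeff_equivariant {w : V ≃ₗ[ℝ] V} (hw : w ∈ K.weylGroup) (b : I → ℝ) :
    ∃ b' : I → ℝ, w (∑ k, b k • K.α k) = ∑ k, b' k • K.α k ∧
      ∀ x, ∑ k, b' k * K.d k * K.coroot k (w x) = ∑ k, b k * K.d k * K.coroot k x := by
  refine K.weyl_induction (p := fun w => ∃ b' : I → ℝ, w (∑ k, b k • K.α k) = ∑ k, b' k • K.α k ∧
      ∀ x, ∑ k, b' k * K.d k * K.coroot k (w x) = ∑ k, b k * K.d k * K.coroot k x)
    ⟨b, rfl, fun x => rfl⟩ (fun j w hw ih => ?_) hw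
  · obtain ⟨c, hc, hc'⟩ := ih
    have hs : ∀ k, (K.d k : ℝ) * K.a k j = K.d j * K.a j k := fun k => by
      exact_mod_cast K.symmetrizable k j
    refine ⟨fun k => c k - if k = j then ∑ l, c l * K.a j l else 0, ?_, fun x => ?_⟩
    · rw [K.sum_update_smul, LinearEquiv.mul_apply, hc, refl_apply, map_sum]
      simp only [map_smul, K.cartanPairing, smul_eq_mul]
    · rw [← hc' x, LinearEquiv.mul_apply]
      generalize w x = y
      simp only [refl_apply, map_sub, map_smul, K.cartanPairing, smul_eq_mul, sub_mul, mul_sub,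
        Finset.sum_sub_distrib, ite_mul, zero_mul, Finset.sum_ite_eq', Finset.mem_univ, if_true,
        K.diag]
      have : ∑ k, c k * K.d k * (K.coroot j y * K.a k j)
          = (∑ l, c l * K.a j l) * K.d j * K.coroot j y := by
        rw [Finset.sum_mul, Finset.sum_mul]
        refine Finset.sum_congr rfl fun k _ => ?_
        linear_combination (c k * K.coroot j y) * hs k
      rw [this]
      push_cast
      ring

/-- A positive real root proportional to a simple root defines the same reflection. -/
lemma conj_refl_eq_of_proportional {w : V ≃ₗ[ℝ] V} (hw : w ∈ K.weylGroup) {i j : I} {c : ℕ}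
    (h : w (K.α i) = (c : ℝ) • K.α j) (x : V) :
    0 < c ∧ w (K.refl i (w.symm x)) = K.refl j x ∧
      K.coroot j x = c * K.coroot i (w.symm x) := by
  obtain ⟨b, hb, hb'⟩ := K.exists_coeff_equivariant hw fun k => if k = i then 1 else 0
  rw [K.sum_single_smul, one_smul, h, ← K.sum_single_smul] at hb
  have hb2 := K.coeff_unique hb
  subst hb2
  have key : ∀ y, (c : ℝ) * K.d j * K.coroot j (w y) = K.d i * K.coroot i y := by
    intro y
    have := hb' y
    simpa [ite_mul] using this
  have h1 := key (K.α i)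
  rw [h, map_smul, coroot_α_self, coroot_α_self, smul_eq_mul] at h1
  have hdi : (0 : ℝ) < K.d i := by exact_mod_cast K.dPos i
  have hdj : (0 : ℝ) < K.d j := by exact_mod_cast K.dPos j
  have hc : c ≠ 0 := by
    rintro rfl
    simp at h1
    exact (K.dPos i).ne' h1
  have hc' : (c : ℝ) ≠ 0 := by exact_mod_cast hc
  have h2 := key (w.symm x)
  rw [LinearEquiv.apply_symm_apply] at h2
  have h3 : K.coroot j x = c * K.coroot i (w.symm x) := by
    have : (c : ℝ) * K.d j ≠ 0 := mul_ne_zero hc' hdj.ne'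
    apply mul_left_cancel₀ this
    rw [h2]
    linear_combination (-K.coroot i (w.symm x) / 2) * h1
  refine ⟨Nat.pos_of_ne_zero hc, ?_, h3⟩
  rw [conj_refl_apply, h, refl_apply, h3, smul_smul, mul_comm]

end KacMoodyData

end LSPaper

namespace LSPaper

namespace KacMoodyData

variable {I V : Type*} [Fintype I] [DecidableEq I] [AddCommGroup V] [Module ℝ V]
variable (K : KacMoodyData I V)

/-! ### Every real root is positive or negative -/

/-- The length of a Weyl group element with respect to the simple reflections. -/
def len (w : V ≃ₗ[ℝ] V) : ℕ := sInf {n | ∃ l : List I, l.length = n ∧ (l.map K.refl).prod = w}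

lemma len_prod_le (l : List I) : K.len (l.map K.refl).prod ≤ l.length := Nat.sInf_le ⟨l, rfl, rfl⟩

lemma exists_reduced_word {w : V ≃ₗ[ℝ] V} (hw : w ∈ K.weylGroup) :
    ∃ l : List I, l.length = K.len w ∧ (l.map K.refl).prod = w := by
  obtain ⟨l, hl⟩ := K.exists_word hw
  exact Nat.sInf_mem (s := {n | ∃ l : List I, l.length = n ∧ (l.map K.refl).prod = w})
    ⟨_, l, rfl, hl⟩

lemma len_one : K.len 1 = 0 := Nat.le_zero.1 (K.len_prod_le [])

lemma len_refl_le (i : I) : K.len (K.refl i) ≤ 1 := by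
  simpa using K.len_prod_le [i]

lemma len_mul_le {u v : V ≃ₗ[ℝ] V} (hu : u ∈ K.weylGroup) (hv : v ∈ K.weylGroup) :
    K.len (u * v) ≤ K.len u + K.len v := by
  obtain ⟨l, hl, rfl⟩ := K.exists_reduced_word hu
  obtain ⟨l', hl', rfl⟩ := K.exists_reduced_word hv
  rw [← hl, ← hl', ← List.prod_append, ← List.map_append, ← List.length_append]
  exact K.len_prod_le _

/-- The alternating product of `k` simple reflections `r_s`, `r_t`, with rightmost factor `r_t`. -/
def alt (s t : I) : ℕ → (V ≃ₗ[ℝ] V)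
  | 0 => 1
  | k + 1 => K.refl (if Even k then t else s) * alt s t k

lemma alt_mem (s t : I) (k : ℕ) : K.alt s t k ∈ K.weylGroup := by
  induction k with
  | zero => exact K.weylGroup.one_mem
  | succ k ih => exact K.weylGroup.mul_mem (K.refl_mem _) ih

lemma len_alt_le (s t : I) (k : ℕ) : K.len (K.alt s t k) ≤ k := by
  induction k with
  | zero => exact K.len_one.le
  | succ k ih =>
    have h1 := K.len_mul_le (K.refl_mem (if Even k then t else s)) (K.alt_mem s t k)
    have h2 := K.len_refl_le (if Even k then t else s)
    rw [alt]
    lia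

lemma alt_split (s t : I) (m n : ℕ) :
    ∃ u ∈ K.weylGroup, K.len u ≤ n ∧ K.alt s t (m + n) = u * K.alt s t m := by
  induction n with
  | zero => exact ⟨1, K.weylGroup.one_mem, K.len_one.le, (one_mul _).symm⟩
  | succ n ih =>
    obtain ⟨u, hu, hlen, h⟩ := ih
    refine ⟨K.refl (if Even (m + n) then t else s) * u, K.weylGroup.mul_mem (K.refl_mem _) hu, ?_, ?_⟩
    · have h1 := K.len_mul_le (K.refl_mem (if Even (m + n) then t else s)) hu
      have h2 := K.len_refl_le (if Even (m + n) then t else s)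
      lia
    · rw [← add_assoc, alt, h, mul_assoc]

lemma refl_left_coords (s t : I) (x : V) (p q : ℝ) :
    K.refl s (x + p • K.α s + q • K.α t)
      = x + (-p - K.coroot s x - q * K.a s t) • K.α s + q • K.α t := by
  simp only [refl_apply, map_add, map_smul, K.cartanPairing, K.diag]
  push_cast
  module

lemma refl_right_coords (s t : I) (x : V) (p q : ℝ) :
    K.refl t (x + p • K.α s + q • K.α t)
      = x + p • K.α s + (-q - K.coroot t x - p * K.a t s) • K.α t := by
  simp only [refl_apply, map_add, map_smul, K.cartanPairing, K.diag]
  push_cast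
  module

/-- `p α_s + q α_t` with natural number coefficients. -/
def Qplus₂ (s t : I) (x : V) : Prop := ∃ p q : ℕ, x = (p : ℝ) • K.α s + (q : ℝ) • K.α t

lemma alt_coords_succ {s t : I} {k : ℕ} {p q : ℤ}
    (h : K.alt s t k (K.α s) = (p : ℝ) • K.α s + (q : ℝ) • K.α t) :
    K.alt s t (k + 1) (K.α s) = if Even k
      then (p : ℝ) • K.α s + ((-q - p * K.a t s : ℤ) : ℝ) • K.α t
      else ((-p - q * K.a s t : ℤ) : ℝ) • K.α s + (q : ℝ) • K.α t := by
  rw [alt, LinearEquiv.mul_apply, h]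
  split_ifs
  · simpa using K.refl_right_coords s t 0 p q
  · simpa using K.refl_left_coords s t 0 p q

lemma alt_zero_coords (s t : I) :
    K.alt s t 0 (K.α s) = ((1 : ℤ) : ℝ) • K.α s + ((0 : ℤ) : ℝ) • K.α t := by
  simp [alt]

lemma Qplus₂_of_int {s t : I} {x : V} {p q : ℤ} (h : x = (p : ℝ) • K.α s + (q : ℝ) • K.α t)
    (hp : 0 ≤ p) (hq : 0 ≤ q) : K.Qplus₂ s t x := by
  lift p to ℕ using hp
  lift q to ℕ using hq
  exact ⟨p, q, by exact_mod_cast h⟩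

lemma alt_Qplus₂_of_four_le {s t : I} (hs : K.a s t ≤ 0) (ht : K.a t s ≤ 0)
    (h4 : 4 ≤ K.a s t * K.a t s) (k : ℕ) : K.Qplus₂ s t (K.alt s t k (K.α s)) := by
  suffices h : ∃ p q : ℤ, 0 ≤ p ∧ 0 ≤ q ∧
      K.alt s t k (K.α s) = (p : ℝ) • K.α s + (q : ℝ) • K.α t ∧
      (Even k → -K.a s t * q ≤ 2 * p) ∧ (¬ Even k → -K.a t s * p ≤ 2 * q) by
    obtain ⟨p, q, hp, hq, h, -⟩ := h
    exact K.Qplus₂_of_int h hp hq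
  induction k with
  | zero => exact ⟨1, 0, by simp, le_rfl, K.alt_zero_coords s t, by simp, by simp⟩
  | succ k ih =>
    obtain ⟨p, q, hp, hq, h, h1, h2⟩ := ih
    have h' := K.alt_coords_succ h
    by_cases hk : Even k
    · rw [if_pos hk] at h'
      have e := h1 hk
      have e2 : 2 * q ≤ -K.a t s * p := by nlinarith
      refine ⟨p, _, hp, ?_, h', fun h => absurd hk (Nat.even_add_one.1 h), fun _ => ?_⟩ <;> nlinarith
    · rw [if_neg hk] at h'
      have e := h2 hk
      have e2 : 2 * p ≤ -K.a s t * q := by nlinarith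
      refine ⟨_, q, ?_, hq, h', fun _ => ?_, fun h => absurd (Nat.even_add_one.2 hk) h⟩ <;> nlinarith

/-- The coefficients of `alt s t k (α_s)`, where `x = a_{st}` and `y = a_{ts}`. -/
def altCoeff (x y : ℤ) : ℕ → ℤ × ℤ
  | 0 => (1, 0)
  | k + 1 => if Even k
      then ((altCoeff x y k).1, -(altCoeff x y k).2 - (altCoeff x y k).1 * y)
      else (-(altCoeff x y k).1 - (altCoeff x y k).2 * x, (altCoeff x y k).2)

lemma alt_eq_altCoeff (s t : I) (k : ℕ) : K.alt s t k (K.α s) =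
    ((altCoeff (K.a s t) (K.a t s) k).1 : ℝ) • K.α s +
      ((altCoeff (K.a s t) (K.a t s) k).2 : ℝ) • K.α t := by
  induction k with
  | zero => exact K.alt_zero_coords s t
  | succ k ih =>
    rw [K.alt_coords_succ ih, altCoeff]
    split_ifs <;> rfl

lemma alt_dichotomy_of_finite {s t : I} (m : ℕ)
    (hpos : ∀ k ≤ m, 0 ≤ (altCoeff (K.a s t) (K.a t s) k).1 ∧
      0 ≤ (altCoeff (K.a s t) (K.a t s) k).2)
    (hbraid : ∀ z : V, K.alt s t (m + 1) (K.refl s (z + (0 : ℝ) • K.α s + (0 : ℝ) • K.α t))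
      = K.alt s t m (z + (0 : ℝ) • K.α s + (0 : ℝ) • K.α t)) :
    ∃ m, (∀ k ≤ m, K.Qplus₂ s t (K.alt s t k (K.α s))) ∧
        K.alt s t (m + 1) * K.refl s = K.alt s t m := by
  refine ⟨m, fun k hk => K.Qplus₂_of_int (K.alt_eq_altCoeff s t k) (hpos k hk).1 (hpos k hk).2, ?_⟩
  ext z
  simpa using hbraid z

lemma finite_type_cases {x y : ℤ} (hx : x ≤ 0) (hy : y ≤ 0) (hz : x = 0 ↔ y = 0)
    (h4 : ¬ 4 ≤ x * y) :
    (x = 0 ∧ y = 0) ∨ (x = -1 ∧ y = -1) ∨ (x = -1 ∧ y = -2) ∨ (x = -2 ∧ y = -1) ∨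
      (x = -1 ∧ y = -3) ∨ (x = -3 ∧ y = -1) := by
  by_cases hx0 : x = 0
  · exact Or.inl ⟨hx0, hz.1 hx0⟩
  have hy0 : y ≠ 0 := fun h => hx0 (hz.2 h)
  have : x ≤ -1 := by omega
  have : y ≤ -1 := by omega
  have : -3 ≤ x := by nlinarith
  have : -3 ≤ y := by nlinarith
  interval_cases x <;> interval_cases y <;> simp_all

lemma alt_dichotomy {s t : I} (hst : s ≠ t) :
    (∀ k, K.Qplus₂ s t (K.alt s t k (K.α s))) ∨
      ∃ m, (∀ k ≤ m, K.Qplus₂ s t (K.alt s t k (K.α s))) ∧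
        K.alt s t (m + 1) * K.refl s = K.alt s t m := by
  have hs := K.offDiag s t hst
  have ht := K.offDiag t s hst.symm
  by_cases h4 : 4 ≤ K.a s t * K.a t s
  · exact Or.inl (K.alt_Qplus₂_of_four_le hs ht h4)
  right
  have e1 : ¬ Even 1 := by decide
  have e2 : Even 2 := by decide
  have e3 : ¬ Even 3 := by decide
  have e4 : Even 4 := by decide
  have e5 : ¬ Even 5 := by decide
  rcases finite_type_cases hs ht (K.zeroIff s t) h4 with h | h | h | h | h | h
  · refine K.alt_dichotomy_of_finite 1 ?_ fun z => ?_
    · rw [h.1, h.2]; decide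
    · simp only [alt, LinearEquiv.mul_apply, LinearEquiv.coe_one, id_eq, Even.zero, e1, if_true, if_false,
        refl_left_coords, refl_right_coords, h.1, h.2]
      push_cast
      module
  · refine K.alt_dichotomy_of_finite 2 ?_ fun z => ?_
    · rw [h.1, h.2]; decide
    · simp only [alt, LinearEquiv.mul_apply, LinearEquiv.coe_one, id_eq, Even.zero, e1, e2, if_true,
        if_false, refl_left_coords, refl_right_coords, h.1, h.2]
      push_cast
      module
  iterate 2
    · refine K.alt_dichotomy_of_finite 3 ?_ fun z => ?_
      · rw [h.1, h.2]; decide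
      · simp only [alt, LinearEquiv.mul_apply, LinearEquiv.coe_one, id_eq, Even.zero, e1, e2, e3, if_true,
          if_false, refl_left_coords, refl_right_coords, h.1, h.2]
        push_cast
        module
  iterate 2
    · refine K.alt_dichotomy_of_finite 5 ?_ fun z => ?_
      · rw [h.1, h.2]; decide
      · simp only [alt, LinearEquiv.mul_apply, LinearEquiv.coe_one, id_eq, Even.zero, e1, e2, e3, e4, e5,
          if_true, if_false, refl_left_coords, refl_right_coords, h.1, h.2]
        push_cast
        module

lemma Qplus_add {x y : V} (hx : x ∈ K.Qplus) (hy : y ∈ K.Qplus) : x + y ∈ K.Qplus := by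
  obtain ⟨c, rfl⟩ := hx
  obtain ⟨d, rfl⟩ := hy
  refine ⟨c + d, ?_⟩
  simp only [Pi.add_apply, Nat.cast_add, add_smul, Finset.sum_add_distrib]

lemma Qplus_smul {x : V} (n : ℕ) (hx : x ∈ K.Qplus) : (n : ℝ) • x ∈ K.Qplus := by
  obtain ⟨c, rfl⟩ := hx
  refine ⟨fun i => n * c i, ?_⟩
  simp only [Finset.smul_sum, Nat.cast_mul, mul_smul]

lemma α_mem_Qplus (i : I) : K.α i ∈ K.Qplus :=
  ⟨fun k => if k = i then 1 else 0, by simp [ite_smul]⟩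

/-- If right multiplication by `r_s` does not decrease the length of `w`, then `w α_s` is
positive. -/
lemma weyl_α_mem_Qplus (n : ℕ) : ∀ w ∈ K.weylGroup, K.len w = n → ∀ s : I,
    n ≤ K.len (w * K.refl s) → w (K.α s) ∈ K.Qplus := by
  induction n using Nat.strong_induction_on with
  | _ n ih =>
  intro w hw hn s hs
  rcases Nat.eq_zero_or_pos n with rfl | hpos
  · obtain ⟨l, hl, rfl⟩ := K.exists_reduced_word hw
    rw [hn] at hl
    rw [List.eq_nil_of_length_eq_zero hl]
    exact K.α_mem_Qplus s
  obtain ⟨t, ht⟩ : ∃ t, K.len (w * K.refl t) + 1 ≤ n := by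
    obtain ⟨l, hl, rfl⟩ := K.exists_reduced_word hw
    rcases List.eq_nil_or_concat' l with rfl | ⟨l', t, rfl⟩
    · rw [hn] at hl
      exact absurd hl hpos.ne
    · refine ⟨t, ?_⟩
      have := K.len_prod_le l'
      simp only [List.map_append, List.map_cons, List.map_nil, List.prod_append, List.prod_cons,
        List.prod_nil, mul_one, mul_assoc, refl_mul_self, List.length_append, List.length_cons,
        List.length_nil] at hl hn ⊢
      lia
  have hst : s ≠ t := by
    rintro rfl
    lia
  have hex : ∃ k, k ≤ n ∧ ∃ v ∈ K.weylGroup, w = v * K.alt s t k ∧ K.len v + k = n ∧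
      ∀ k', k < k' → ¬ ∃ v ∈ K.weylGroup, w = v * K.alt s t k' ∧ K.len v + k' = n := by
    let p : ℕ → Prop := fun k => ∃ v ∈ K.weylGroup, w = v * K.alt s t k ∧ K.len v + k = n
    have hp0 : p 0 := ⟨w, hw, by simp [alt], by simpa using hn⟩
    refine ⟨Nat.findGreatest p n, Nat.findGreatest_le n, ?_⟩
    obtain ⟨v, hv, h1, h2⟩ := Nat.findGreatest_spec (P := p) (Nat.zero_le n) hp0
    refine ⟨v, hv, h1, h2, fun k' hk' hpk => ?_⟩
    by_cases hkn : k' ≤ n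
    · exact Nat.findGreatest_is_greatest hk' hkn hpk
    · obtain ⟨v, -, -, h⟩ := hpk
      lia
  obtain ⟨k, hkn, v, hv, hwv, hlen, hmax⟩ := hex
  have hk0 : k ≠ 0 := by
    rintro rfl
    refine hmax 1 one_pos ⟨w * K.refl t, K.weylGroup.mul_mem hw (K.refl_mem t), ?_, ?_⟩
    · simp [alt, mul_assoc, refl_mul_self]
    · have h1 := K.len_mul_le (K.weylGroup.mul_mem hw (K.refl_mem t)) (K.refl_mem t)
      have h2 := K.len_refl_le t
      rw [mul_assoc, refl_mul_self, mul_one] at h1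
      lia
  obtain ⟨j, rfl⟩ := Nat.exists_eq_succ_of_ne_zero hk0
  have hv1 : K.len v ≤ K.len (v * K.refl (if Even j then s else t)) := by
    by_contra! hlt
    refine hmax (j + 2) (by lia) ⟨v * K.refl (if Even j then s else t),
      K.weylGroup.mul_mem hv (K.refl_mem _), ?_, ?_⟩
    · rw [alt, show (if Even (j + 1) then t else s) = if Even j then s else t by
        by_cases h : Even j <;> simp [h, Nat.even_add_one], mul_assoc, ← mul_assoc (K.refl _) (K.refl _), refl_mul_self,
        one_mul, hwv]
    · have h1 := K.len_mul_le (K.weylGroup.mul_mem hv (K.refl_mem (if Even j then s else t)))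
        (K.refl_mem (if Even j then s else t))
      have h2 := K.len_refl_le (if Even j then s else t)
      rw [mul_assoc, refl_mul_self, mul_one] at h1
      lia
  have hv2 : K.len v ≤ K.len (v * K.refl (if Even j then t else s)) := by
    by_contra! hlt
    have h1 := K.len_mul_le (K.weylGroup.mul_mem hv (K.refl_mem (if Even j then t else s)))
      (K.alt_mem s t j)
    have h2 := K.len_alt_le s t j
    rw [mul_assoc, ← alt, ← hwv] at h1
    lia
  have hpos : v (K.α s) ∈ K.Qplus ∧ v (K.α t) ∈ K.Qplus := by
    have hvn : K.len v < n := by lia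
    by_cases hj : Even j
    · rw [if_pos hj] at hv1 hv2
      exact ⟨ih _ hvn v hv rfl s hv1, ih _ hvn v hv rfl t hv2⟩
    · rw [if_neg hj] at hv1 hv2
      exact ⟨ih _ hvn v hv rfl s hv2, ih _ hvn v hv rfl t hv1⟩
  have hQ : K.Qplus₂ s t (K.alt s t (j + 1) (K.α s)) := by
    rcases K.alt_dichotomy hst with h | ⟨m, h, hm⟩
    · exact h _
    · by_cases hjm : j + 1 ≤ m
      · exact h _ hjm
      exfalso
      obtain ⟨d, hd⟩ : ∃ d, j + 1 = (m + 1) + d := ⟨j - m, by lia⟩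
      obtain ⟨u, hu, hud, hsplit⟩ := K.alt_split s t (m + 1) d
      have e : w * K.refl s = v * u * K.alt s t m := by
        rw [hwv, Nat.succ_eq_add_one, hd, hsplit, mul_assoc, mul_assoc, hm, mul_assoc]
      have h1 := K.len_mul_le (K.weylGroup.mul_mem hv hu) (K.alt_mem s t m)
      have h2 := K.len_mul_le hv hu
      have h3 := K.len_alt_le s t m
      rw [e] at hs
      lia
  obtain ⟨p, q, hpq⟩ := hQ
  rw [hwv, LinearEquiv.mul_apply, hpq, map_add, map_smul, map_smul]
  exact K.Qplus_add (K.Qplus_smul p hpos.1) (K.Qplus_smul q hpos.2)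

/-- Every real root is positive or negative. -/
lemma root_pos_or_neg {w : V ≃ₗ[ℝ] V} (hw : w ∈ K.weylGroup) (s : I) :
    w (K.α s) ∈ K.Qplus ∨ -w (K.α s) ∈ K.Qplus := by
  by_cases h : K.len w ≤ K.len (w * K.refl s)
  · exact Or.inl (K.weyl_α_mem_Qplus _ w hw rfl s h)
  · right
    have := K.weyl_α_mem_Qplus _ (w * K.refl s) (K.weylGroup.mul_mem hw (K.refl_mem s)) rfl s
      (by rw [mul_assoc, refl_mul_self, mul_one]; lia)
    rwa [LinearEquiv.mul_apply, refl_α_self, map_neg] at this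

/-- A simple reflection permutes the positive real roots not proportional to its root. -/
lemma refl_root_mem_Qplus {w : V ≃ₗ[ℝ] V} (hw : w ∈ K.weylGroup) {i : I}
    (h : w (K.α i) ∈ K.Qplus) (j : I) :
    (∃ c : ℕ, w (K.α i) = (c : ℝ) • K.α j) ∨ (K.refl j * w) (K.α i) ∈ K.Qplus := by
  obtain ⟨c, hc⟩ := h
  by_cases h0 : ∀ k, k ≠ j → c k = 0
  · left
    refine ⟨c j, hc.trans ?_⟩
    rw [Finset.sum_eq_single j (fun k _ hk => by rw [h0 k hk]; simp) (by simp)]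
  right
  push Not at h0
  obtain ⟨k, hkj, hk⟩ := h0
  refine (K.root_pos_or_neg (K.weylGroup.mul_mem (K.refl_mem j) hw) i).resolve_right ?_
  rintro ⟨e, he⟩
  rw [LinearEquiv.mul_apply, refl_apply, hc, ← K.sum_update_smul, ← Finset.sum_neg_distrib] at he
  simp only [← neg_smul] at he
  have h1 := congrFun (K.coeff_unique he) k
  simp only [if_neg hkj, sub_zero] at h1
  have h2 : (0 : ℝ) < c k := by exact_mod_cast Nat.pos_of_ne_zero hk
  have h3 : (0 : ℝ) ≤ e k := Nat.cast_nonneg _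
  linarith

end KacMoodyData

end LSPaper

namespace LSPaper

section Chains

variable {X : Type*} {R : X → X → Prop}

lemma exists_seq_succ_iff (p : ℕ) (a b : X) :
    (∃ ξ : ℕ → X, ξ 0 = a ∧ ξ (p + 1) = b ∧ ∀ q < p + 1, R (ξ q) (ξ (q + 1))) ↔
      ∃ c, (∃ ξ : ℕ → X, ξ 0 = a ∧ ξ p = c ∧ ∀ q < p, R (ξ q) (ξ (q + 1))) ∧ R c b := by
  constructor
  · rintro ⟨ξ, rfl, rfl, h⟩
    exact ⟨ξ p, ⟨ξ, rfl, rfl, fun q hq => h q (by lia)⟩, h p (by lia)⟩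
  · rintro ⟨c, ⟨ξ, rfl, rfl, h⟩, hc⟩
    refine ⟨fun q => if q ≤ p then ξ q else b, by simp, by simp, fun q hq => ?_⟩
    rcases Nat.lt_succ_iff_lt_or_eq.1 hq with hq | rfl
    · have h1 : q ≤ p := by lia
      have h2 : q + 1 ≤ p := by lia
      simpa only [h1, h2, if_true] using h q hq
    · simpa using hc

lemma exists_seq_iff_reflTransGen (a b : X) :
    (∃ p, ∃ ξ : ℕ → X, ξ 0 = a ∧ ξ p = b ∧ ∀ q < p, R (ξ q) (ξ (q + 1))) ↔
      Relation.ReflTransGen R a b := by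
  constructor
  · rintro ⟨p, h⟩
    induction p generalizing b with
    | zero =>
      obtain ⟨ξ, rfl, rfl, -⟩ := h
      exact .refl
    | succ p ih =>
      obtain ⟨c, hc, hcb⟩ := (exists_seq_succ_iff p a b).1 h
      exact (ih c hc).tail hcb
  · intro h
    induction h with
    | refl => exact ⟨0, fun _ => a, rfl, rfl, by simp⟩
    | tail _ hbc ih =>
      obtain ⟨p, hp⟩ := ih
      exact ⟨p + 1, (exists_seq_succ_iff p a _).2 ⟨_, hp, hbc⟩⟩

lemma exists_seq_iff_transGen (a b : X) :
    (∃ p, 0 < p ∧ ∃ ξ : ℕ → X, ξ 0 = a ∧ ξ p = b ∧ ∀ q < p, R (ξ q) (ξ (q + 1))) ↔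
      Relation.TransGen R a b := by
  rw [Relation.TransGen.tail'_iff]
  simp only [← exists_seq_iff_reflTransGen]
  constructor
  · rintro ⟨p, hp, h⟩
    obtain ⟨p, rfl⟩ := Nat.exists_eq_succ_of_ne_zero hp.ne'
    obtain ⟨c, hc, hcb⟩ := (exists_seq_succ_iff p a b).1 h
    exact ⟨c, ⟨p, hc⟩, hcb⟩
  · rintro ⟨c, ⟨p, hc⟩, hcb⟩
    exact ⟨p + 1, p.succ_pos, (exists_seq_succ_iff p a b).2 ⟨c, hc, hcb⟩⟩

end Chains

namespace KacMoodyData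

variable {I V : Type*} [Fintype I] [DecidableEq I] [AddCommGroup V] [Module ℝ V]
variable (K : KacMoodyData I V)

lemma chainLen_zero {ν ν' : V} : K.chainLen 0 ν ν' ↔ ν = ν' :=
  ⟨by rintro ⟨ξ, rfl, rfl, -⟩; rfl, by rintro rfl; exact ⟨fun _ => ν, rfl, rfl, by simp⟩⟩

lemma chainLen_succ {p : ℕ} {ν ν' : V} :
    K.chainLen (p + 1) ν ν' ↔ ∃ η, K.chainLen p ν η ∧ K.StepDown η ν' :=
  exists_seq_succ_iff p ν ν'

lemma chainLen_one {ν ν' : V} : K.chainLen 1 ν ν' ↔ K.StepDown ν ν' := by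
  rw [chainLen_succ]
  simp [chainLen_zero]

lemma chainLen_add {p q : ℕ} {a b c : V} (h : K.chainLen p a b) (h' : K.chainLen q b c) :
    K.chainLen (p + q) a c := by
  induction q generalizing c with
  | zero => rwa [← K.chainLen_zero.1 h']
  | succ q ih =>
    obtain ⟨d, hd, hdc⟩ := K.chainLen_succ.1 h'
    exact K.chainLen_succ.2 ⟨d, ih hd, hdc⟩

lemma chainLen_cons {p : ℕ} {a b c : V} (h : K.StepDown a b) (h' : K.chainLen p b c) :
    K.chainLen (p + 1) a c := by
  rw [add_comm]
  exact K.chainLen_add (K.chainLen_one.2 h) h'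

lemma exists_of_chainLen_succ {p : ℕ} {a c : V} (h : K.chainLen (p + 1) a c) :
    ∃ b, K.StepDown a b ∧ K.chainLen p b c := by
  obtain ⟨ξ, rfl, rfl, h⟩ := h
  exact ⟨ξ 1, h 0 p.succ_pos, fun q => ξ (q + 1), rfl, rfl, fun q hq => h (q + 1) (by lia)⟩

lemma stepDown_eq_add {ν ν' : V} (hν : ν ∈ K.P) (h : K.StepDown ν ν') :
    ∃ c : I → ℕ, ν' = ν + ∑ i, (c i : ℝ) • K.α i ∧ 1 ≤ ∑ i, c i := by
  obtain ⟨w, hw, i, ⟨c, hc⟩, hneg, rfl⟩ := h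
  obtain ⟨n, hn⟩ := K.pairingInt i _ (K.weyl_mem_P (K.symm_mem hw) hν)
  rw [hn] at hneg
  have hneg' : n < 0 := by exact_mod_cast hneg
  obtain ⟨k, rfl⟩ : ∃ k : ℕ, n = -((k : ℤ) + 1) := ⟨(-n - 1).toNat, by lia⟩
  refine ⟨fun i => (k + 1) * c i, ?_, ?_⟩
  · rw [conj_refl_apply, hn, hc]
    push_cast
    simp only [mul_smul, ← Finset.smul_sum]
    module
  · by_contra h0
    have h0 : ∑ i, (k + 1) * c i = 0 := by lia
    simp only [Finset.sum_eq_zero_iff, Finset.mem_univ, true_imp_iff, Nat.mul_eq_zero] at h0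
    refine K.weyl_α_ne_zero w i ?_
    rw [hc]
    refine Finset.sum_eq_zero fun j _ => ?_
    have : c j = 0 := by
      rcases h0 j with h | h
      · lia
      · exact h
    simp [this]

lemma stepDown_mem_orbit {μ ν ν' : V} (hν : ν ∈ K.orbit μ) (h : K.StepDown ν ν') :
    ν' ∈ K.orbit μ := by
  obtain ⟨w, hw, i, -, -, rfl⟩ := h
  exact K.conj_refl_mem_orbit hw i hν

lemma stepDown_mem_P {ν ν' : V} (hν : ν ∈ K.P) (h : K.StepDown ν ν') : ν' ∈ K.P :=
  K.orbit_subset_P hν (K.stepDown_mem_orbit ⟨1, K.weylGroup.one_mem, rfl⟩ h)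

lemma chainLen_eq_add {p : ℕ} {ν ν' : V} (hν : ν ∈ K.P) (h : K.chainLen p ν ν') :
    ν' ∈ K.P ∧ ∃ c : I → ℕ, ν' = ν + ∑ i, (c i : ℝ) • K.α i ∧ p ≤ ∑ i, c i := by
  induction p generalizing ν' with
  | zero =>
    obtain rfl := K.chainLen_zero.1 h
    exact ⟨hν, 0, by simp, by simp⟩
  | succ p ih =>
    obtain ⟨η, hη, hs⟩ := K.chainLen_succ.1 h
    obtain ⟨hP, c, rfl, hc⟩ := ih hη
    obtain ⟨d, rfl, hd⟩ := K.stepDown_eq_add hP hs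
    refine ⟨K.stepDown_mem_P hP hs, c + d, ?_, ?_⟩
    · simp only [Pi.add_apply, Nat.cast_add, add_smul, Finset.sum_add_distrib]
      abel
    · simp only [Pi.add_apply, Finset.sum_add_distrib]
      lia

lemma chainLen_bddAbove {ν : V} (hν : ν ∈ K.P) (ν' : V) : BddAbove {p | K.chainLen p ν ν'} := by
  by_cases hne : ∃ p, K.chainLen p ν ν'
  · obtain ⟨p, hp⟩ := hne
    obtain ⟨-, c, hc, -⟩ := K.chainLen_eq_add hν hp
    refine ⟨∑ i, c i, fun q hq => ?_⟩
    obtain ⟨-, d, hd, hqd⟩ := K.chainLen_eq_add hν hq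
    have : (fun i => (d i : ℝ)) = fun i => (c i : ℝ) :=
      K.coeff_unique (add_left_cancel (hd.symm.trans hc))
    have : d = c := funext fun i => by exact_mod_cast congrFun this i
    rwa [← this]
  · exact ⟨0, fun q hq => absurd ⟨q, hq⟩ hne⟩

lemma le_dist {p : ℕ} {ν ν' : V} (hν : ν ∈ K.P) (h : K.chainLen p ν ν') : p ≤ K.dist ν ν' :=
  le_csSup (K.chainLen_bddAbove hν ν') h

lemma dist_eq_one {ν ν' : V} (hν : ν ∈ K.P) (h : K.StepDown ν ν')
    (h' : ∀ p, K.chainLen p ν ν' → p ≤ 1) : K.dist ν ν' = 1 :=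
  le_antisymm (csSup_le ⟨1, K.chainLen_one.2 h⟩ h') (K.le_dist hν (K.chainLen_one.2 h))

lemma conj_refl_refl (j : I) (w : V ≃ₗ[ℝ] V) (i : I) (ξ : V) :
    (K.refl j * w) (K.refl i ((K.refl j * w).symm (K.refl j ξ))) =
      K.refl j (w (K.refl i (w.symm ξ))) ∧
    K.coroot i ((K.refl j * w).symm (K.refl j ξ)) = K.coroot i (w.symm ξ) := by
  have h : (K.refl j * w).symm (K.refl j ξ) = w.symm ξ := by
    rw [LinearEquiv.symm_apply_eq]
    simp
  rw [h]
  exact ⟨rfl, rfl⟩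

lemma stepDown_cases {ν ν' : V} (h : K.StepDown ν ν') (j : I) :
    ν' = K.refl j ν ∨ K.StepDown (K.refl j ν) (K.refl j ν') := by
  obtain ⟨w, hw, i, hpos, hneg, rfl⟩ := h
  rcases K.refl_root_mem_Qplus hw hpos j with ⟨c, hc⟩ | hc
  · exact Or.inl (K.conj_refl_eq_of_proportional hw hc ν).2.1
  · obtain ⟨h1, h2⟩ := K.conj_refl_refl j w i ν
    exact Or.inr ⟨K.refl j * w, K.weylGroup.mul_mem (K.refl_mem j) hw, i, hc, h2 ▸ hneg, h1.symm⟩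

lemma stepDown_refl {ν : V} {j : I} (h : K.coroot j ν < 0) : K.StepDown ν (K.refl j ν) :=
  ⟨1, K.weylGroup.one_mem, j, K.α_mem_Qplus j, h, rfl⟩

lemma stepDown_refl' {ν : V} {j : I} (h : 0 < K.coroot j ν) : K.StepDown (K.refl j ν) ν := by
  have := K.stepDown_refl (ν := K.refl j ν) (j := j) (by rw [coroot_refl_self]; linarith)
  rwa [refl_refl] at this

lemma chainLen_refl_or (j : I) {p : ℕ} {ν ν' : V} (h : K.chainLen p ν ν') :
    K.chainLen p (K.refl j ν) (K.refl j ν') ∨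
      ∃ q, p = q + 1 ∧ K.chainLen q (K.refl j ν) ν' := by
  induction p generalizing ν' with
  | zero =>
    obtain rfl := K.chainLen_zero.1 h
    exact Or.inl (K.chainLen_zero.2 rfl)
  | succ p ih =>
    obtain ⟨η, hη, hs⟩ := K.chainLen_succ.1 h
    rcases ih hη with hc | ⟨q, rfl, hc⟩
    · rcases K.stepDown_cases hs j with rfl | hs'
      · exact Or.inr ⟨p, rfl, hc⟩
      · exact Or.inl (K.chainLen_succ.2 ⟨_, hc, hs'⟩)
    · exact Or.inr ⟨q + 1, rfl, K.chainLen_succ.2 ⟨_, hc, hs⟩⟩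

lemma chainLen_refl_or' (j : I) {p : ℕ} {ν ν' : V} (h : K.chainLen p ν ν') :
    K.chainLen p (K.refl j ν) (K.refl j ν') ∨
      ∃ q, p = q + 1 ∧ K.chainLen q ν (K.refl j ν') := by
  induction p generalizing ν with
  | zero =>
    obtain rfl := K.chainLen_zero.1 h
    exact Or.inl (K.chainLen_zero.2 rfl)
  | succ p ih =>
    obtain ⟨η, hs, hη⟩ := K.exists_of_chainLen_succ h
    rcases ih hη with hc | ⟨q, rfl, hc⟩
    · rcases K.stepDown_cases hs j with rfl | hs'
      · rw [refl_refl] at hc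
        exact Or.inr ⟨p, rfl, hc⟩
      · exact Or.inl (K.chainLen_cons hs' hc)
    · exact Or.inr ⟨q + 1, rfl, K.chainLen_cons hs hc⟩

lemma chainLen_refl_of_neg {j : I} {p : ℕ} {ν ν' : V} (h : K.chainLen p ν ν')
    (hneg : K.coroot j ν' < 0) : K.chainLen p (K.refl j ν) (K.refl j ν') := by
  rcases K.chainLen_refl_or j h with hc | ⟨q, rfl, hc⟩
  · exact hc
  · exact K.chainLen_succ.2 ⟨_, hc, K.stepDown_refl hneg⟩

lemma chainLen_refl_of_pos {j : I} {p : ℕ} {ν ν' : V} (h : K.chainLen p ν ν')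
    (hpos : 0 < K.coroot j ν) : K.chainLen p (K.refl j ν) (K.refl j ν') := by
  rcases K.chainLen_refl_or' j h with hc | ⟨q, rfl, hc⟩
  · exact hc
  · exact K.chainLen_cons (K.stepDown_refl' hpos) hc

lemma dist_refl {ν : V} (hν : ν ∈ K.P) {j : I} (h : K.coroot j ν < 0) :
    K.dist ν (K.refl j ν) = 1 := by
  refine K.dist_eq_one hν (K.stepDown_refl h) fun p hp => ?_
  rcases p with - | p
  · lia
  obtain ⟨η, hs, hη⟩ := K.exists_of_chainLen_succ hp
  have hηP := K.stepDown_mem_P hν hs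
  obtain ⟨c, hc, hc1⟩ := K.stepDown_eq_add hν hs
  obtain ⟨-, d, hd, hpd⟩ := K.chainLen_eq_add hηP hη
  have hcd : (fun i => (c i + d i : ℝ)) = fun i => if i = j then -K.coroot j ν else 0 := by
    apply K.coeff_unique
    rw [sum_single_smul]
    rw [hc, refl_apply] at hd
    simp only [add_smul, Finset.sum_add_distrib]
    have : ν + -(K.coroot j ν • K.α j) =
      ν + (∑ i, (c i : ℝ) • K.α i + ∑ i, (d i : ℝ) • K.α i) := by
      rw [← sub_eq_add_neg, hd]; abel
    rw [neg_smul]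
    exact (add_left_cancel this).symm
  have hsupp : ∀ i, i ≠ j → c i = 0 ∧ d i = 0 := by
    intro i hi
    have := congrFun hcd i
    simp only [hi, if_false] at this
    have : c i + d i = 0 := by exact_mod_cast this
    lia
  have hη' : η = K.refl j ν := by
    rcases K.stepDown_cases hs j with h1 | h1
    · exact h1
    · exfalso
      obtain ⟨e, he, he1⟩ := K.stepDown_eq_add (K.refl_mem_P j hν) h1
      have hc' : ∑ i, (c i : ℝ) • K.α i = (c j : ℝ) • K.α j := by
        rw [Finset.sum_eq_single j (fun i _ hi => by simp [(hsupp i hi).1]) (by simp)]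
      rw [hc, hc', map_add, map_smul, refl_α_self] at he
      have he' : ∑ i, (e i : ℝ) • K.α i = ∑ i, (if i = j then -(c j : ℝ) else 0) • K.α i := by
        rw [sum_single_smul, ← add_left_cancel he, smul_neg, neg_smul]
      have he2 := K.coeff_unique he'
      have h0 : ∀ i, e i = 0 := by
        intro i
        have h2 := congrFun he2 i
        by_cases hi : i = j
        · simp only [hi, if_true] at h2
          rw [hi]
          have h3 : (e j : ℝ) + c j = 0 := by rw [h2]; ring
          have h3 : e j + c j = 0 := by exact_mod_cast h3
          lia
        · simp only [hi, if_false] at h2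
          exact_mod_cast h2
      simp [h0] at he1
  rw [hη'] at hd
  have hd0 : ∑ i, (d i : ℝ) • K.α i = ∑ i, (0 : ℝ) • K.α i := by
    simpa using hd
  have := K.coeff_unique hd0
  have h0 : ∀ i, d i = 0 := fun i => by exact_mod_cast congrFun this i
  simp [h0] at hpd
  lia

end KacMoodyData

end LSPaper

namespace LSPaper

namespace KacMoodyData

variable {I V : Type*} [Fintype I] [DecidableEq I] [AddCommGroup V] [Module ℝ V]
variable (K : KacMoodyData I V)

/-- One step of a `σ`-chain. -/
def CoverStep (σ : ℝ) (ξ ξ' : V) : Prop :=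
  K.dist ξ ξ' = 1 ∧
    ∃ w ∈ K.weylGroup, ∃ i : I, w (K.α i) ∈ K.Qplus ∧
      ξ' = w (K.refl i (w.symm ξ)) ∧
      ∃ n : ℤ, n < 0 ∧ σ * K.coroot i (w.symm ξ) = (n : ℝ)

/-- The existence of a (possibly trivial) `σ`-chain. -/
def Jump (σ : ℝ) : V → V → Prop := Relation.ReflTransGen (K.CoverStep σ)

variable {K}

lemma sigmaChain_iff {σ : ℚ} {ν ν' : V} :
    K.SigmaChain σ ν ν' ↔ Relation.TransGen (K.CoverStep σ) ν ν' :=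
  exists_seq_iff_transGen (R := K.CoverStep (σ : ℝ)) ν ν'

lemma CoverStep.stepDown {σ : ℝ} (hσ : 0 < σ) {ξ ξ' : V} (h : K.CoverStep σ ξ ξ') :
    K.StepDown ξ ξ' := by
  obtain ⟨-, w, hw, i, hpos, rfl, n, hn, hσn⟩ := h
  refine ⟨w, hw, i, hpos, ?_, rfl⟩
  have : (n : ℝ) < 0 := by exact_mod_cast hn
  rw [← hσn] at this
  exact neg_of_mul_neg_right this hσ.le

lemma CoverStep.mem_orbit {σ : ℝ} {μ ξ ξ' : V} (h : K.CoverStep σ ξ ξ') (hξ : ξ ∈ K.orbit μ) :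
    ξ' ∈ K.orbit μ := by
  obtain ⟨-, w, hw, i, -, rfl, -⟩ := h
  exact K.conj_refl_mem_orbit hw i hξ

lemma Jump.mem_orbit {σ : ℝ} {μ ξ ξ' : V} (h : K.Jump σ ξ ξ') (hξ : ξ ∈ K.orbit μ) :
    ξ' ∈ K.orbit μ := by
  induction h with
  | refl => exact hξ
  | tail _ h ih => exact h.mem_orbit ih

variable (K) in
lemma self_mem_orbit (μ : V) : μ ∈ K.orbit μ := ⟨1, K.weylGroup.one_mem, rfl⟩

lemma CoverStep.mem_P {σ : ℝ} {ξ ξ' : V} (h : K.CoverStep σ ξ ξ') (hξ : ξ ∈ K.P) :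
    ξ' ∈ K.P :=
  K.orbit_subset_P hξ (h.mem_orbit (K.self_mem_orbit ξ))

lemma Jump.mem_P {σ : ℝ} {ξ ξ' : V} (h : K.Jump σ ξ ξ') (hξ : ξ ∈ K.P) : ξ' ∈ K.P :=
  K.orbit_subset_P hξ (h.mem_orbit (K.self_mem_orbit ξ))

lemma CoverStep.exists_int {σ : ℝ} {ξ ξ' : V} (h : K.CoverStep σ ξ ξ') (j : I) :
    ∃ n : ℤ, σ * K.coroot j ξ' = σ * K.coroot j ξ + n := by
  obtain ⟨-, w, hw, i, -, rfl, n, -, hn⟩ := h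
  obtain ⟨k, hk⟩ := K.pairingInt j _ (K.weyl_mem_P hw (K.rootMem i))
  refine ⟨-n * k, ?_⟩
  rw [conj_refl_apply, map_sub, map_smul, smul_eq_mul, hk]
  push_cast
  rw [← hn]
  ring

lemma Jump.exists_int {σ : ℝ} {ξ ξ' : V} (h : K.Jump σ ξ ξ') (j : I) :
    ∃ n : ℤ, σ * K.coroot j ξ' = σ * K.coroot j ξ + n := by
  induction h with
  | refl => exact ⟨0, by simp⟩
  | tail _ h ih =>
    obtain ⟨n, hn⟩ := ih
    obtain ⟨k, hk⟩ := h.exists_int j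
    exact ⟨n + k, by rw [hk, hn]; push_cast; ring⟩

lemma coverStep_refl {σ : ℝ} (hσ : 0 < σ) {ν : V} (hν : ν ∈ K.P) {j : I}
    (h : K.coroot j ν < 0) (hz : ∃ n : ℤ, σ * K.coroot j ν = n) :
    K.CoverStep σ ν (K.refl j ν) := by
  obtain ⟨n, hn⟩ := hz
  refine ⟨K.dist_refl hν h, 1, K.weylGroup.one_mem, j, K.α_mem_Qplus j, rfl, n, ?_, hn⟩
  have : (n : ℝ) < 0 := hn ▸ mul_neg_of_pos_of_neg hσ h
  exact_mod_cast this

lemma coverStep_refl' {σ : ℝ} (hσ : 0 < σ) {ν : V} (hν : ν ∈ K.P) {j : I}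
    (h : 0 < K.coroot j ν) (hz : ∃ n : ℤ, σ * K.coroot j ν = n) :
    K.CoverStep σ (K.refl j ν) ν := by
  obtain ⟨n, hn⟩ := hz
  have := coverStep_refl hσ (K.refl_mem_P j hν) (j := j)
    (by rw [coroot_refl_self]; linarith) ⟨-n, by rw [coroot_refl_self]; push_cast; rw [← hn]; ring⟩
  rwa [refl_refl] at this

/-- A step of a `σ`-chain is either the reflection `r_j`, or it is compatible with `r_j`. -/
lemma CoverStep.cases {σ : ℝ} (hσ : 0 < σ) {ξ ξ' : V} (hξ : ξ ∈ K.P)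
    (h : K.CoverStep σ ξ ξ') (j : I) :
    (ξ' = K.refl j ξ ∧ K.coroot j ξ < 0 ∧ ∃ n : ℤ, σ * K.coroot j ξ = n) ∨
      ((K.coroot j ξ < 0 → K.coroot j ξ' < 0) ∧ (0 < K.coroot j ξ' → 0 < K.coroot j ξ) ∧
        (K.coroot j ξ < 0 ∨ 0 < K.coroot j ξ' →
          K.CoverStep σ (K.refl j ξ) (K.refl j ξ'))) := by
  have hstep := h.stepDown hσ
  obtain ⟨hd, w, hw, i, hpos, hξ', n, hn, hσn⟩ := h
  have hle : ∀ p, K.chainLen p ξ ξ' → p ≤ 1 := fun p hp => hd ▸ K.le_dist hξ hp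
  rcases K.refl_root_mem_Qplus hw hpos j with ⟨c, hc⟩ | hc
  · left
    obtain ⟨hc0, hr, hcor⟩ := K.conj_refl_eq_of_proportional hw hc ξ
    refine ⟨by rw [hξ', hr], ?_, c * n, ?_⟩
    · have h1 : (n : ℝ) < 0 := by exact_mod_cast hn
      rw [← hσn] at h1
      rw [hcor]
      exact mul_neg_of_pos_of_neg (by exact_mod_cast hc0) (neg_of_mul_neg_right h1 hσ.le)
    · rw [hcor]
      push_cast
      rw [← hσn]
      ring
  · right
    obtain ⟨h1, h2⟩ := K.conj_refl_refl j w i ξ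
    rw [← hξ'] at h1
    have hneg : K.coroot i (w.symm ξ) < 0 := by
      have h1 : (n : ℝ) < 0 := by exact_mod_cast hn
      rw [← hσn] at h1
      exact neg_of_mul_neg_right h1 hσ.le
    have hw' := K.weylGroup.mul_mem (K.refl_mem j) hw
    have hs' : K.StepDown (K.refl j ξ) (K.refl j ξ') :=
      ⟨_, hw', i, hc, h2 ▸ hneg, h1.symm⟩
    refine ⟨fun hneg => ?_, fun hpos => ?_, fun hor => ?_⟩
    · by_contra! h0
      have hlen : K.chainLen 2 ξ (K.refl j ξ') :=
        K.chainLen_cons (K.stepDown_refl hneg) (K.chainLen_one.2 hs')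
      rcases h0.eq_or_lt with h0 | h0
      · rw [K.refl_eq_self h0.symm] at hlen
        have := hle _ hlen
        lia
      · have := hle _ (K.chainLen_succ.2 ⟨_, hlen, K.stepDown_refl' h0⟩)
        lia
    · by_contra! h0
      have hlen : K.chainLen 2 (K.refl j ξ) ξ' :=
        K.chainLen_cons hs' (K.chainLen_one.2 (K.stepDown_refl' hpos))
      rcases h0.eq_or_lt with h0 | h0
      · rw [K.refl_eq_self h0] at hlen
        have := hle _ hlen
        lia
      · have := hle _ (K.chainLen_cons (K.stepDown_refl h0) hlen)
        lia
    · refine ⟨K.dist_eq_one (K.refl_mem_P j hξ) hs' fun p hp => hle p ?_, _, hw', i, hc, h1.symm,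
        n, hn, by rw [h2, hσn]⟩
      have hp' : K.chainLen p (K.refl j (K.refl j ξ)) (K.refl j (K.refl j ξ')) := by
        rcases hor with hor | hor
        · exact K.chainLen_refl_of_pos hp (by rw [coroot_refl_self]; linarith)
        · exact K.chainLen_refl_of_neg hp (by rw [coroot_refl_self]; linarith)
      rwa [refl_refl, refl_refl] at hp'

lemma Jump.cases_of_neg {σ : ℝ} (hσ : 0 < σ) {a b : V} (ha : a ∈ K.P) {j : I}
    (h : K.Jump σ a b) (hneg : K.coroot j a < 0) :
    (K.coroot j b < 0 ∧ K.Jump σ (K.refl j a) (K.refl j b)) ∨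
      (K.Jump σ (K.refl j a) b ∧ ∃ n : ℤ, σ * K.coroot j b = n) := by
  induction h with
  | refl => exact Or.inl ⟨hneg, .refl⟩
  | @tail b c hab hbc ih =>
    have hbP : b ∈ K.P := Jump.mem_P hab ha
    rcases ih with ⟨hb, hJ⟩ | ⟨hJ, n, hn⟩
    · rcases hbc.cases hσ hbP j with ⟨rfl, -, n, hn⟩ | ⟨h1, -, h3⟩
      · exact Or.inr ⟨hJ, -n, by rw [coroot_refl_self]; push_cast; rw [← hn]; ring⟩
      · exact Or.inl ⟨h1 hb, hJ.tail (h3 (Or.inl hb))⟩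
    · obtain ⟨k, hk⟩ := hbc.exists_int j
      exact Or.inr ⟨hJ.tail hbc, n + k, by rw [hk, hn]; push_cast; ring⟩

lemma Jump.cases_of_pos {σ : ℝ} (hσ : 0 < σ) {a b : V} (ha : a ∈ K.P) {j : I}
    (h : K.Jump σ a b) (hpos : 0 < K.coroot j b) :
    (0 < K.coroot j a ∧ K.Jump σ (K.refl j a) (K.refl j b)) ∨
      (K.Jump σ a (K.refl j b) ∧ ∃ n : ℤ, σ * K.coroot j a = n) := by
  induction h using Relation.ReflTransGen.head_induction_on with
  | refl => exact Or.inl ⟨hpos, .refl⟩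
  | @head a c hac hcb ih =>
    rcases ih (hac.mem_P ha) with ⟨hc, hJ⟩ | ⟨hJ, n, hn⟩
    · rcases hac.cases hσ ha j with ⟨rfl, -, n, hn⟩ | ⟨-, h1, h3⟩
      · rw [refl_refl] at hJ
        exact Or.inr ⟨hJ, n, hn⟩
      · exact Or.inl ⟨h1 hc, hJ.head (h3 (Or.inr hc))⟩
    · obtain ⟨k, hk⟩ := hac.exists_int j
      exact Or.inr ⟨hJ.head hac, n - k, by push_cast; rw [← hn, hk]; ring⟩

lemma Jump.refl_of_neg {σ : ℝ} (hσ : 0 < σ) {a b : V} (ha : a ∈ K.P) {j : I}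
    (h : K.Jump σ a b) (hneg : K.coroot j a < 0) (hneg' : K.coroot j b < 0) :
    K.Jump σ (K.refl j a) (K.refl j b) := by
  rcases h.cases_of_neg hσ ha hneg with ⟨-, hJ⟩ | ⟨hJ, hz⟩
  · exact hJ
  · exact hJ.tail (coverStep_refl hσ (h.mem_P ha) hneg' hz)

lemma Jump.refl_left_of_neg {σ : ℝ} (hσ : 0 < σ) {a b : V} (ha : a ∈ K.P) {j : I}
    (h : K.Jump σ a b) (hneg : K.coroot j a < 0) (hb : 0 ≤ K.coroot j b) :
    K.Jump σ (K.refl j a) b ∧ ∃ n : ℤ, σ * K.coroot j b = n := by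
  rcases h.cases_of_neg hσ ha hneg with ⟨hb', -⟩ | hJ
  · exact absurd hb' hb.not_gt
  · exact hJ

lemma Jump.refl_of_pos {σ : ℝ} (hσ : 0 < σ) {a b : V} (ha : a ∈ K.P) {j : I}
    (h : K.Jump σ a b) (hpos : 0 < K.coroot j a) (hpos' : 0 < K.coroot j b) :
    K.Jump σ (K.refl j a) (K.refl j b) := by
  rcases h.cases_of_pos hσ ha hpos' with ⟨-, hJ⟩ | ⟨hJ, hz⟩
  · exact hJ
  · exact hJ.head (coverStep_refl' hσ ha hpos hz)

lemma Jump.refl_right_of_pos {σ : ℝ} (hσ : 0 < σ) {a b : V} (ha : a ∈ K.P) {j : I}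
    (h : K.Jump σ a b) (ha' : K.coroot j a ≤ 0) (hpos : 0 < K.coroot j b) :
    K.Jump σ a (K.refl j b) ∧ ∃ n : ℤ, σ * K.coroot j a = n := by
  rcases h.cases_of_pos hσ ha hpos with ⟨hb', -⟩ | hJ
  · exact absurd hb' ha'.not_gt
  · exact hJ

lemma StepDown.smul {ν ν' : V} (h : K.StepDown ν ν') {c : ℝ} (hc : 0 < c) :
    K.StepDown (c • ν) (c • ν') := by
  obtain ⟨w, hw, i, hpos, hneg, rfl⟩ := h
  refine ⟨w, hw, i, hpos, ?_, by simp only [map_smul]⟩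
  rw [map_smul, map_smul, smul_eq_mul]
  exact mul_neg_of_pos_of_neg hc hneg

lemma chainLen_smul {p : ℕ} {ν ν' : V} (h : K.chainLen p ν ν') {c : ℝ} (hc : 0 < c) :
    K.chainLen p (c • ν) (c • ν') := by
  obtain ⟨ξ, rfl, rfl, h⟩ := h
  exact ⟨fun q => c • ξ q, rfl, rfl, fun q hq => (h q hq).smul hc⟩

lemma dist_smul (ν ν' : V) {c : ℝ} (hc : 0 < c) : K.dist (c • ν) (c • ν') = K.dist ν ν' := by
  unfold dist
  congr 1
  ext p
  refine ⟨fun h => ?_, fun h => chainLen_smul h hc⟩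
  have := chainLen_smul h (inv_pos.2 hc)
  rwa [inv_smul_smul₀ hc.ne', inv_smul_smul₀ hc.ne'] at this

lemma CoverStep.inv_smul {t : ℝ} {m k : ℕ} (hm : 0 < m) (hk : 0 < m * t - k) {ξ ξ' : V}
    (hξ : (m : ℝ)⁻¹ • ξ ∈ K.P) (h : K.CoverStep t ξ ξ') :
    K.CoverStep (m * t - k) ((m : ℝ)⁻¹ • ξ) ((m : ℝ)⁻¹ • ξ') := by
  have hm' : (0 : ℝ) < m := by exact_mod_cast hm
  have ht : 0 < t := by
    have : (0 : ℝ) ≤ k := k.cast_nonneg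
    exact pos_of_mul_pos_right (by linarith) hm'.le
  obtain ⟨hd, w, hw, i, hpos, rfl, n, hn, hn'⟩ := h
  obtain ⟨l, hl⟩ := K.pairingInt i _ (K.weyl_mem_P (K.symm_mem hw) hξ)
  have hcor : K.coroot i (w.symm ξ) = m * l := by
    rw [← hl, map_smul, map_smul, smul_eq_mul, mul_inv_cancel_left₀ hm'.ne']
  have heq : (m * t - k) * K.coroot i (w.symm ((m : ℝ)⁻¹ • ξ)) = (n - k * l : ℤ) := by
    rw [hl]
    push_cast
    rw [← hn', hcor]
    ring
  refine ⟨by rw [dist_smul _ _ (inv_pos.2 hm'), hd], w, hw, i, hpos, by simp only [map_smul],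
    n - k * l, ?_, heq⟩
  have h1 : (n : ℝ) < 0 := by exact_mod_cast hn
  rw [← hn', hcor] at h1
  have h2 : (l : ℝ) < 0 := neg_of_mul_neg_right (neg_of_mul_neg_right h1 ht.le) hm'.le
  have : ((n - k * l : ℤ) : ℝ) < 0 := by
    rw [← heq, hl]
    exact mul_neg_of_pos_of_neg hk h2
  exact_mod_cast this

lemma Jump.inv_smul {t : ℝ} {m k : ℕ} (hm : 0 < m) (hk : 0 < m * t - k) {ξ ξ' : V}
    (hξ : (m : ℝ)⁻¹ • ξ ∈ K.P) (h : K.Jump t ξ ξ') :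
    K.Jump (m * t - k) ((m : ℝ)⁻¹ • ξ) ((m : ℝ)⁻¹ • ξ') := by
  suffices (m : ℝ)⁻¹ • ξ' ∈ K.P ∧ K.Jump (m * t - k) ((m : ℝ)⁻¹ • ξ) ((m : ℝ)⁻¹ • ξ') from this.2
  induction h with
  | refl => exact ⟨hξ, .refl⟩
  | tail _ h ih =>
    have := h.inv_smul hm hk ih.1
    exact ⟨this.mem_P ih.1, ih.2.tail this⟩

end KacMoodyData

end LSPaper

namespace LSPaper

open Filter Topology

section Slopes

variable {V : Type*} [AddCommGroup V] [Module ℝ V]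

/-- `f` is affine of slope `ν` immediately to the right of `t`. -/
def RSlope (f : ℝ → V) (t : ℝ) (ν : V) : Prop := ∀ᶠ x in 𝓝[>] t, f x = f t + (x - t) • ν

/-- `f` is affine of slope `ν` immediately to the left of `t`. -/
def LSlope (f : ℝ → V) (t : ℝ) (ν : V) : Prop := ∀ᶠ x in 𝓝[<] t, f x = f t + (x - t) • ν

/-- `f` is affine of slope `ν` on `[a, b]`. -/
def SegSlope (f : ℝ → V) (a b : ℝ) (ν : V) : Prop := ∀ x ∈ Set.Icc a b, f x = f a + (x - a) • ν

variable {f : ℝ → V} {a b t : ℝ} {ν ν' : V}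

lemma slope_unique {l : Filter ℝ} [l.NeBot] (h : ∀ᶠ x in l, f x = f t + (x - t) • ν)
    (h' : ∀ᶠ x in l, f x = f t + (x - t) • ν') (hl : ∀ᶠ x in l, x ≠ t) : ν = ν' := by
  obtain ⟨x, hx, hx', hne⟩ := (h.and (h'.and hl)).exists
  exact smul_right_injective V (sub_ne_zero.2 hne) (add_left_cancel (hx.symm.trans hx'))

lemma LSlope.unique (h : LSlope f t ν) (h' : LSlope f t ν') : ν = ν' :=
  slope_unique h h' (eventually_mem_of_tendsto_nhdsWithin tendsto_id |>.mono fun _ hx => ne_of_lt hx)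

lemma RSlope.exists_seg (h : RSlope f t ν) (hb : t < b) :
    ∃ c, t < c ∧ c ≤ b ∧ SegSlope f t c ν := by
  obtain ⟨u, hu, hsub⟩ := (mem_nhdsGT_iff_exists_Ioo_subset' hb).1 h
  have hu : t < u := hu
  refine ⟨min b ((t + u) / 2), lt_min hb (by linarith), min_le_left _ _, fun x hx => ?_⟩
  rcases hx.1.eq_or_lt with rfl | hx1
  · simp
  · exact hsub ⟨hx1, by have := hx.2.trans (min_le_right _ _); linarith⟩

lemma LSlope.exists_seg (h : LSlope f t ν) (ha : a < t) :
    ∃ c, a ≤ c ∧ c < t ∧ SegSlope f c t ν := by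
  obtain ⟨u, hu, hsub⟩ := (mem_nhdsLT_iff_exists_Ioo_subset' ha).1 h
  have hu : u < t := hu
  have key : ∀ x, max a ((u + t) / 2) ≤ x → x ≤ t → f x = f t + (x - t) • ν := by
    intro x hx hxt
    rcases hxt.eq_or_lt with rfl | hx1
    · simp
    · exact hsub ⟨by have := (le_max_right _ _).trans hx; linarith, hx1⟩
  have hlt : max a ((u + t) / 2) < t := max_lt ha (by linarith)
  refine ⟨max a ((u + t) / 2), le_max_left _ _, hlt, fun x hx => ?_⟩
  rw [key x hx.1 hx.2, key _ le_rfl hlt.le]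
  module

lemma SegSlope.mono (h : SegSlope f a b ν) {c d : ℝ} (hc : a ≤ c) (hd : d ≤ b) :
    SegSlope f c d ν := fun x hx => by
  rw [h x ⟨hc.trans hx.1, hx.2.trans hd⟩, h c ⟨hc, (hx.1.trans hx.2).trans hd⟩]
  module

lemma SegSlope.rslope_left (h : SegSlope f a b ν) (hab : a < b) : RSlope f a ν := by
  filter_upwards [Ioo_mem_nhdsGT hab] with x hx using h x ⟨hx.1.le, hx.2.le⟩

lemma SegSlope.rslope (h : SegSlope f a b ν) (ha : a ≤ t) (hb : t < b) : RSlope f t ν :=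
  (h.mono ha le_rfl).rslope_left hb

lemma SegSlope.lslope (h : SegSlope f a b ν) (ha : a < t) (hb : t ≤ b) : LSlope f t ν := by
  filter_upwards [Ioo_mem_nhdsLT ha] with x hx
  rw [h x ⟨hx.1.le, hx.2.le.trans hb⟩, h t ⟨ha.le, hb⟩]
  module

lemma SegSlope.trans {c : ℝ} (h : SegSlope f a b ν) (hab : a ≤ b) (h' : SegSlope f b c ν) :
    SegSlope f a c ν := fun x hx => by
  rcases le_total x b with hb | hb
  · exact h x ⟨hx.1, hb⟩
  · rw [h' x ⟨hb, hx.2⟩, h b ⟨hab, le_rfl⟩]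
    module

end Slopes

namespace KacMoodyData

variable {I V : Type*} [Fintype I] [DecidableEq I] [AddCommGroup V] [Module ℝ V]
variable (K : KacMoodyData I V)

/-- A description of LS paths of shape `lam` by their local slopes. -/
structure WeakLS (lam : V) (f : ℝ → V) : Prop where
  of_nonpos : ∀ t ≤ 0, f t = 0
  of_one_le : ∀ t, 1 ≤ t → f t = f 1
  right_zero : ∃ ν ∈ K.orbit lam, RSlope f 0 ν
  left_one : ∃ ν ∈ K.orbit lam, LSlope f 1 ν
  jump : ∀ t, 0 < t → t < 1 → ∃ ν ∈ K.orbit lam, ∃ ν' ∈ K.orbit lam,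
    LSlope f t ν ∧ RSlope f t ν' ∧ K.Jump t ν ν'

/-- The path `f` is, on `[0, τ]`, an initial piece of an LS path of shape `lam`, which may be
continued from the breakpoint `τ` with slope `ν`. -/
inductive Built (lam : V) (f : ℝ → V) : ℚ → V → Prop
  | zero {ν : V} (hν : ν ∈ K.orbit lam) : Built lam f 0 ν
  | step {τ τ' : ℚ} {ν ν' : V} (h : Built lam f τ ν) (hlt : τ < τ') (hseg : SegSlope f τ τ' ν)
      (hJ : Relation.TransGen (K.CoverStep τ') ν ν') : Built lam f τ' ν'

variable {K}

namespace Built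

variable {lam : V} {f : ℝ → V} {τ : ℚ} {ν : V}

lemma nonneg (h : K.Built lam f τ ν) : 0 ≤ τ := by
  induction h with
  | zero => exact le_rfl
  | step _ hlt _ _ ih => exact ih.trans hlt.le

lemma mem_orbit (h : K.Built lam f τ ν) : ν ∈ K.orbit lam := by
  induction h with
  | zero hν => exact hν
  | step _ _ _ hJ ih => exact Jump.mem_orbit hJ.to_reflTransGen ih

lemma local_slopes (h : K.Built lam f τ ν) :
    (0 < τ → ∃ ν ∈ K.orbit lam, RSlope f 0 ν) ∧
    (0 < τ → ∃ ν' ∈ K.orbit lam, LSlope f τ ν' ∧ K.Jump τ ν' ν) ∧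
    ∀ t : ℝ, 0 < t → t < τ → ∃ ν ∈ K.orbit lam, ∃ ν' ∈ K.orbit lam,
      LSlope f t ν ∧ RSlope f t ν' ∧ K.Jump t ν ν' := by
  induction h with
  | zero hν =>
    refine ⟨by simp, by simp, fun t h1 h2 => ?_⟩
    simp only [Rat.cast_zero] at h2
    linarith
  | @step τ τ' ν ν' h hlt hseg hJ ih =>
    obtain ⟨h0, h1, h2⟩ := ih
    have hlt' : (τ : ℝ) < τ' := by exact_mod_cast hlt
    have horb := h.mem_orbit
    refine ⟨fun _ => ?_, fun _ => ⟨ν, horb, hseg.lslope hlt' le_rfl, hJ.to_reflTransGen⟩,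
      fun t ht htτ => ?_⟩
    · rcases h.nonneg.eq_or_lt with h | h
      · refine ⟨ν, horb, ?_⟩
        rw [← h, Rat.cast_zero] at hseg
        rw [← h, Rat.cast_zero] at hlt'
        exact hseg.rslope_left hlt'
      · exact h0 h
    · rcases lt_trichotomy t τ with h3 | rfl | h3
      · exact h2 t ht h3
      · obtain ⟨ν₀, hν₀, hl, hJ'⟩ := h1 (by exact_mod_cast ht)
        exact ⟨ν₀, hν₀, ν, horb, hl, hseg.rslope_left hlt', hJ'⟩
      · exact ⟨ν, horb, ν, horb, hseg.lslope h3 htτ.le, hseg.rslope h3.le htτ, .refl⟩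

lemma exists_int (hf : f 0 = 0) (h : K.Built lam f τ ν) (i : I) :
    (∃ n : ℤ, K.coroot i (f τ) - τ * K.coroot i ν = n) ∧
    ∀ t : ℝ, 0 < t → t ≤ τ → ∃ ν, LSlope f t ν ∧ ∃ n : ℤ, K.coroot i (f t) - t * K.coroot i ν = n := by
  induction h with
  | zero hν =>
    refine ⟨⟨0, by simp [hf]⟩, fun t h1 h2 => ?_⟩
    simp only [Rat.cast_zero] at h2
    linarith
  | @step τ τ' ν ν' h hlt hseg hJ ih =>
    obtain ⟨⟨n, hn⟩, h2⟩ := ih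
    have hlt' : (τ : ℝ) < τ' := by exact_mod_cast hlt
    have key : ∀ t : ℝ, τ ≤ t → t ≤ τ' → K.coroot i (f t) - t * K.coroot i ν = n := by
      intro t h1 h2
      rw [hseg t ⟨h1, h2⟩, map_add, map_smul, smul_eq_mul, ← hn]
      ring
    refine ⟨?_, fun t ht htτ => ?_⟩
    · obtain ⟨k, hk⟩ := Jump.exists_int hJ.to_reflTransGen i
      refine ⟨n - k, ?_⟩
      rw [hk]
      push_cast
      rw [← key τ' hlt'.le le_rfl]
      ring
    · rcases le_or_gt t τ with h3 | h3
      · exact h2 t ht h3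
      · exact ⟨ν, hseg.lslope h3 htτ, n, key t h3.le htτ⟩

lemma exists_seq (h : K.Built lam f τ ν) :
    ∃ (n : ℕ) (N : ℕ → V) (T : ℕ → ℚ), T 0 = 0 ∧ T n = τ ∧ N n = ν ∧ (∀ k ≤ n, N k ∈ K.orbit lam) ∧
      ∀ k < n, T k < T (k + 1) ∧ SegSlope f (T k) (T (k + 1)) (N k) ∧
        Relation.TransGen (K.CoverStep (T (k + 1))) (N k) (N (k + 1)) := by
  induction h with
  | @zero ν hν => exact ⟨0, fun _ => ν, fun _ => 0, rfl, rfl, rfl, fun _ _ => hν, by simp⟩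
  | @step τ τ' ν ν' h hlt hseg hJ ih =>
    obtain ⟨n, N, T, hT0, rfl, rfl, hN, hk⟩ := ih
    refine ⟨n + 1, fun k => if k ≤ n then N k else ν', fun k => if k ≤ n then T k else τ',
      by simpa using hT0, by simp, by simp, fun k hk' => ?_, fun k hk' => ?_⟩
    · dsimp only
      split_ifs with hkn
      · exact hN k hkn
      · exact Jump.mem_orbit hJ.to_reflTransGen h.mem_orbit
    · rcases Nat.lt_succ_iff_lt_or_eq.1 hk' with hk' | rfl
      · have h1 : k ≤ n := by lia
        have h2 : k + 1 ≤ n := by lia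
        simpa only [h1, h2, if_true] using hk k hk'
      · simpa using ⟨hlt, hseg, hJ⟩

end Built

end KacMoodyData

end LSPaper

namespace LSPaper

open Filter Topology

namespace KacMoodyData

variable {I V : Type*} [Fintype I] [DecidableEq I] [AddCommGroup V] [Module ℝ V]
variable {K : KacMoodyData I V} {lam : V} {f : ℝ → V}

namespace LSData

variable (π : K.LSData lam)

lemma τ_nonneg (u : Fin (π.s + 1)) : 0 ≤ π.τ u := by
  rw [← π.τ_zero]
  exact π.τ_mono.monotone (Fin.zero_le u)

lemma τ_le_one (u : Fin (π.s + 1)) : π.τ u ≤ 1 := by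
  rw [← π.τ_last]
  exact π.τ_mono.monotone (Fin.le_last u)

lemma path_of_nonpos {t : ℝ} (ht : t ≤ 0) : π.path t = 0 := by
  refine Finset.sum_eq_zero fun k _ => ?_
  have h : ∀ u, min t ((π.τ u : ℚ) : ℝ) = t := fun u =>
    min_eq_left (ht.trans (by exact_mod_cast π.τ_nonneg u))
  rw [h, h, sub_self, zero_smul]

lemma path_of_one_le {t : ℝ} (ht : 1 ≤ t) : π.path t = π.path 1 := by
  refine Finset.sum_congr rfl fun k _ => ?_
  have h : ∀ u, min t ((π.τ u : ℚ) : ℝ) = min 1 ((π.τ u : ℚ) : ℝ) := fun u => by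
    have : ((π.τ u : ℚ) : ℝ) ≤ 1 := by exact_mod_cast π.τ_le_one u
    rw [min_eq_right this, min_eq_right (this.trans ht)]
  rw [h, h]

lemma path_seg (u : Fin π.s) :
    SegSlope π.path (π.τ u.castSucc) (π.τ u.succ) (π.ν u) := by
  intro x hx
  have hlt : ((π.τ u.castSucc : ℚ) : ℝ) < π.τ u.succ := by
    exact_mod_cast π.τ_mono u.castSucc_lt_succ
  rw [add_comm, ← sub_eq_iff_eq_add]
  simp only [path]
  rw [← Finset.sum_sub_distrib, Finset.sum_eq_single u]
  · rw [min_eq_left hx.2, min_eq_right hx.1, min_eq_left hlt.le, min_self]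
    module
  · intro k _ hk
    rw [← sub_smul]
    rcases lt_or_gt_of_ne hk with hk | hk
    · have h1 : ((π.τ k.succ : ℚ) : ℝ) ≤ π.τ u.castSucc := by
        exact_mod_cast π.τ_mono.monotone (Fin.succ_le_castSucc_iff.2 hk)
      have h2 : ((π.τ k.castSucc : ℚ) : ℝ) ≤ π.τ u.castSucc := by
        exact_mod_cast π.τ_mono.monotone (Fin.castSucc_le_castSucc_iff.2 hk.le)
      rw [min_eq_right h1, min_eq_right h2, min_eq_right (h1.trans hx.1),
        min_eq_right (h2.trans hx.1), sub_self, zero_smul]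
    · have h1 : ((π.τ u.succ : ℚ) : ℝ) ≤ π.τ k.castSucc := by
        exact_mod_cast π.τ_mono.monotone (Fin.succ_le_castSucc_iff.2 hk)
      have h2 : ((π.τ u.succ : ℚ) : ℝ) ≤ π.τ k.succ := by
        exact_mod_cast π.τ_mono.monotone (Fin.succ_le_succ_iff.2 hk.le)
      rw [min_eq_left (hlt.le.trans h1), min_eq_left (hlt.le.trans h2),
        min_eq_left (hx.2.trans h1), min_eq_left (hx.2.trans h2)]
      simp
  · simp

lemma built (u : ℕ) (h : u < π.s) :
    K.Built lam π.path (π.τ ⟨u, Nat.lt_succ_of_lt h⟩) (π.ν ⟨u, h⟩) := by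
  induction u with
  | zero =>
    have : (⟨0, Nat.lt_succ_of_lt h⟩ : Fin (π.s + 1)) = 0 := rfl
    rw [this, π.τ_zero]
    exact .zero (π.mem _)
  | succ u ih =>
    exact .step (ih (by lia)) (π.τ_mono (Fin.mk_lt_mk.2 u.lt_succ_self))
      (π.path_seg ⟨u, by lia⟩) (sigmaChain_iff.1 (π.chainCond u h))

end LSData

lemma exists_built (hf : f ∈ K.B lam) :
    (∀ t ≤ 0, f t = 0) ∧ (∀ t, 1 ≤ t → f t = f 1) ∧
      ∃ τ ν, K.Built lam f τ ν ∧ τ < 1 ∧ SegSlope f τ 1 ν := by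
  obtain ⟨π, rfl⟩ := hf
  refine ⟨fun t => π.path_of_nonpos, fun t => π.path_of_one_le, ?_⟩
  have hs := π.spos
  refine ⟨_, _, π.built (π.s - 1) (by lia), ?_, ?_⟩
  · rw [← π.τ_last]
    exact π.τ_mono (Fin.lt_def.2 (Nat.sub_lt hs one_pos))
  · have h := π.path_seg ⟨π.s - 1, by lia⟩
    have h1 : (⟨π.s - 1, by lia⟩ : Fin π.s).succ = Fin.last π.s := by
      ext
      simp only [Fin.val_succ, Fin.val_last]
      lia
    rw [h1, π.τ_last, Rat.cast_one] at h
    exact h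

lemma mem_B_of_built (hf0 : ∀ t ≤ 0, f t = 0) (hf1 : ∀ t, 1 ≤ t → f t = f 1) {τ : ℚ} {ν : V}
    (h : K.Built lam f τ ν) (hτ : τ < 1) (hseg : SegSlope f τ 1 ν) : f ∈ K.B lam := by
  obtain ⟨n, N, T, hT0, rfl, rfl, hN, hk⟩ := h.exists_seq
  let T' : ℕ → ℚ := fun k => if k ≤ n then T k else 1
  have hT' : ∀ k ≤ n, T' k = T k := fun k hk => if_pos hk
  have hT'n : T' (n + 1) = 1 := if_neg (by lia)
  have hseg' : ∀ k ≤ n, T' k < T' (k + 1) ∧ SegSlope f (T' k) (T' (k + 1)) (N k) := by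
    intro k hkn
    rcases hkn.eq_or_lt with rfl | hlt
    · rw [hT' _ le_rfl, hT'n, Rat.cast_one]
      exact ⟨hτ, hseg⟩
    · rw [hT' _ hkn, hT' _ hlt]
      exact ⟨(hk k hlt).1, (hk k hlt).2.1⟩
  have hpos : ∀ k ≤ n, 0 ≤ T k := by
    intro k
    induction k with
    | zero => intro _; exact hT0.ge
    | succ k ih => intro h; exact (ih (by lia)).trans (hk k (by lia)).1.le
  have hJ : ∀ k, k + 1 < n + 1 → Relation.TransGen (K.CoverStep (T' (k + 1))) (N k) (N (k + 1)) := by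
    intro k hkn
    rw [hT' _ (by lia)]
    exact (hk k (by lia)).2.2
  let π : K.LSData lam :=
    { s := n + 1
      spos := n.succ_pos
      ν := fun u => N u
      τ := fun u => T' u
      mem := fun u => hN u (by lia)
      strictDec := fun u h => by
        refine Relation.TransGen.mono (fun a b hab => CoverStep.stepDown ?_ hab) _ _ (hJ u h)
        rw [hT' _ (by lia)]
        have h1 := hpos u (by lia)
        have h2 := (hk u (by lia)).1
        exact_mod_cast h1.trans_lt h2
      τ_zero := by
        show T' 0 = 0
        rw [hT' 0 (Nat.zero_le _), hT0]
      τ_last := hT'n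
      τ_mono := Fin.strictMono_iff_lt_succ.2 fun u => (hseg' u (by lia)).1
      chainCond := fun u h => sigmaChain_iff.2 (hJ u h) }
  refine ⟨π, funext fun t => ?_⟩
  have key : ∀ k ≤ n + 1, ∀ t : ℝ, t ≤ T' k → f t = π.path t := by
    intro k
    induction k with
    | zero =>
      intro _ t ht
      rw [hT' 0 (Nat.zero_le _), hT0, Rat.cast_zero] at ht
      rw [hf0 t ht, π.path_of_nonpos ht]
    | succ k ih =>
      intro hkn t ht
      rcases le_total t (T' k) with h1 | h1
      · exact ih (by lia) t h1
      · have h2 : SegSlope π.path (T' k) (T' (k + 1)) (N k) := π.path_seg ⟨k, by lia⟩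
        rw [(hseg' k (by lia)).2 t ⟨h1, ht⟩, h2 t ⟨h1, ht⟩, ih (by lia) _ le_rfl]
  have key1 : ∀ t : ℝ, t ≤ 1 → f t = π.path t := fun t ht =>
    key (n + 1) le_rfl t (by rw [hT'n, Rat.cast_one]; exact ht)
  rcases le_total t 1 with ht | ht
  · exact key1 t ht
  · rw [hf1 t ht, π.path_of_one_le ht, key1 1 le_rfl]

lemma weakLS_of_mem_B (hf : f ∈ K.B lam) : K.WeakLS lam f := by
  obtain ⟨h0, h1, τ, ν, hb, hτ, hseg⟩ := exists_built hf
  obtain ⟨hr, hl, hj⟩ := hb.local_slopes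
  have hτ' : (τ : ℝ) < 1 := by exact_mod_cast hτ
  have horb := hb.mem_orbit
  refine ⟨h0, h1, ?_, ⟨ν, horb, hseg.lslope hτ' le_rfl⟩, fun t ht0 ht1 => ?_⟩
  · rcases hb.nonneg.eq_or_lt with h | h
    · rw [← h, Rat.cast_zero] at hseg
      exact ⟨ν, horb, hseg.rslope_left one_pos⟩
    · exact hr h
  · rcases lt_trichotomy t τ with h3 | rfl | h3
    · exact hj t ht0 h3
    · obtain ⟨ν₀, hν₀, hl, hJ'⟩ := hl (by exact_mod_cast ht0)
      exact ⟨ν₀, hν₀, ν, horb, hl, hseg.rslope_left hτ', hJ'⟩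
    · exact ⟨ν, horb, ν, horb, hseg.lslope h3 ht1.le, hseg.rslope h3.le ht1, .refl⟩

lemma exists_int_of_mem_B (hf : f ∈ K.B lam) {t : ℝ} (ht0 : 0 < t) (ht1 : t ≤ 1) {ν : V}
    (hν : LSlope f t ν) (i : I) : ∃ n : ℤ, K.coroot i (f t) - t * K.coroot i ν = n := by
  obtain ⟨h0, h1, τ, ν', hb, hτ, hseg⟩ := exists_built hf
  obtain ⟨⟨n, hn⟩, hz⟩ := hb.exists_int (h0 0 le_rfl) i
  rcases le_or_gt t τ with h3 | h3
  · obtain ⟨ν'', hν'', hn⟩ := hz t ht0 h3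
    rwa [hν.unique hν'']
  · rw [hν.unique (hseg.lslope h3 ht1)]
    refine ⟨n, ?_⟩
    rw [hseg t ⟨h3.le, ht1⟩, map_add, map_smul, smul_eq_mul, ← hn]
    ring

/-- A nontrivial `t`-chain of integral weights forces `t` to be rational. -/
lemma CoverStep.exists_rat {t : ℝ} {ξ ξ' : V} (hξ : ξ ∈ K.P) (h : K.CoverStep t ξ ξ') :
    ∃ q : ℚ, t = q := by
  obtain ⟨-, w, hw, i, -, -, n, hn, hn'⟩ := h
  obtain ⟨k, hk⟩ := K.pairingInt i _ (K.weyl_mem_P (K.symm_mem hw) hξ)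
  have hk0 : (k : ℝ) ≠ 0 := by
    intro h0
    rw [hk, h0, mul_zero] at hn'
    have : n = 0 := by exact_mod_cast hn'.symm
    lia
  refine ⟨n / k, ?_⟩
  push_cast
  rw [eq_div_iff hk0, ← hk, hn']

lemma WeakLS.mem_B (hlam : lam ∈ K.P) (h : K.WeakLS lam f) : f ∈ K.B lam := by
  let Q : ℝ → Prop := fun t => ∃ τ ν, K.Built lam f τ ν ∧ (τ : ℝ) < t ∧ SegSlope f τ t ν
  have hleft : ∀ t ν, LSlope f t ν → 0 < t → (∀ ε < t, ∃ s, ε < s ∧ s ≤ t ∧ Q s) →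
      ∃ τ, K.Built lam f τ ν ∧ (τ : ℝ) < t ∧ SegSlope f τ t ν := by
    intro t ν hν ht hs
    obtain ⟨c, -, hct, hc⟩ := hν.exists_seg ht
    obtain ⟨s, hcs, hst, τ, ν', hb, hτ, hseg⟩ := hs c hct
    obtain rfl : ν' = ν := (hseg.lslope hτ le_rfl).unique (hc.lslope hcs hst)
    exact ⟨τ, hb, hτ.trans_le hst, hseg.trans hτ.le (hc.mono hcs.le le_rfl)⟩
  let S : Set ℝ := {t | 0 < t ∧ t ≤ 1 ∧ Q t}
  have hbdd : BddAbove S := ⟨1, fun t ht => ht.2.1⟩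
  obtain ⟨ν₀, hν₀, hr⟩ := h.right_zero
  obtain ⟨c, hc0, hc1, hc⟩ := hr.exists_seg one_pos
  have hcS : c ∈ S := ⟨hc0, hc1, 0, ν₀, .zero hν₀, by simpa using hc0, by simpa using hc⟩
  have hT0 : 0 < sSup S := hc0.trans_le (le_csSup hbdd hcS)
  have hT1 : sSup S ≤ 1 := csSup_le ⟨c, hcS⟩ fun t ht => ht.2.1
  have happ : ∀ ε < sSup S, ∃ s, ε < s ∧ s ≤ sSup S ∧ Q s := by
    intro ε hε
    obtain ⟨s, hs, hεs⟩ := exists_lt_of_lt_csSup ⟨c, hcS⟩ hε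
    exact ⟨s, hεs, le_csSup hbdd hs, hs.2.2⟩
  rcases hT1.eq_or_lt with hT | hT
  · obtain ⟨ν, -, hν⟩ := h.left_one
    rw [hT] at happ
    obtain ⟨τ, hb, hτ, hseg⟩ := hleft 1 ν hν one_pos happ
    exact mem_B_of_built h.of_nonpos h.of_one_le hb (by exact_mod_cast hτ) hseg
  · exfalso
    obtain ⟨ν, hν, ν', -, hl, hr, hJ⟩ := h.jump _ hT0 hT
    obtain ⟨τ, hb, hτ, hseg⟩ := hleft _ ν hl hT0 happ
    obtain ⟨d, hd0, hd1, hd⟩ := hr.exists_seg hT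
    suffices Q d from absurd (le_csSup hbdd (⟨hT0.trans hd0, hd1, this⟩ : d ∈ S)) hd0.not_ge
    rcases Relation.reflTransGen_iff_eq_or_transGen.1 hJ with rfl | hJ
    · exact ⟨τ, ν', hb, hτ.trans hd0, hseg.trans hτ.le hd⟩
    · obtain ⟨η, hη, -⟩ := Relation.TransGen.head'_iff.1 hJ
      obtain ⟨q, hq⟩ := hη.exists_rat (K.orbit_subset_P hlam hν)
      rw [hq] at hd hd0 hτ hseg hJ
      exact ⟨q, ν', hb.step (by exact_mod_cast hτ) hseg hJ, hd0, hd⟩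

end KacMoodyData

end LSPaper

namespace LSPaper

open Filter Topology

section Slopes

variable {V : Type*} [AddCommGroup V] [Module ℝ V] {f g : ℝ → V} {t b : ℝ} {ν : V}

lemma RSlope.map (h : RSlope f t ν) (A : V →ₗ[ℝ] V) (c : V) (hb : t < b)
    (hg : ∀ x ∈ Set.Icc t b, g x = A (f x) + c) : RSlope g t (A ν) := by
  filter_upwards [h, Ioo_mem_nhdsGT hb] with x hx hxb
  rw [hg x ⟨hxb.1.le, hxb.2.le⟩, hg t ⟨le_rfl, hb.le⟩, hx, map_add, map_smul]
  abel

lemma LSlope.map (h : LSlope f t ν) (A : V →ₗ[ℝ] V) (c : V) (hb : b < t)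
    (hg : ∀ x ∈ Set.Icc b t, g x = A (f x) + c) : LSlope g t (A ν) := by
  filter_upwards [h, Ioo_mem_nhdsLT hb] with x hx hxb
  rw [hg x ⟨hxb.1.le, hxb.2.le⟩, hg t ⟨hb.le, le_rfl⟩, hx, map_add, map_smul]
  abel

lemma RSlope.exists_gt (h : RSlope f t ν) (L : V →ₗ[ℝ] ℝ) {p : ℝ → Prop} (hb : t < b)
    (hp : ∀ x, t < x → x < b → p x) : ∃ x > t, p x ∧ L (f x) = L (f t) + (x - t) * L ν := by
  obtain ⟨x, hx, hxb⟩ := (Filter.Eventually.and h (Ioo_mem_nhdsGT hb)).exists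
  exact ⟨x, hxb.1, hp x hxb.1 hxb.2, by rw [hx, map_add, map_smul, smul_eq_mul]⟩

lemma LSlope.exists_lt (h : LSlope f t ν) (L : V →ₗ[ℝ] ℝ) {p : ℝ → Prop} (hb : b < t)
    (hp : ∀ x, b < x → x < t → p x) : ∃ x < t, p x ∧ L (f x) = L (f t) + (x - t) * L ν := by
  obtain ⟨x, hx, hxb⟩ := (Filter.Eventually.and h (Ioo_mem_nhdsLT hb)).exists
  exact ⟨x, hxb.2, hp x hxb.1 hxb.2, by rw [hx, map_add, map_smul, smul_eq_mul]⟩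

lemma RSlope.pos (h : RSlope f t ν) (L : V →ₗ[ℝ] ℝ) (hb : t < b)
    (hp : ∀ x, t < x → x < b → L (f t) < L (f x)) : 0 < L ν := by
  obtain ⟨x, hx, hlt, heq⟩ := h.exists_gt L hb hp
  exact pos_of_mul_pos_right (by linarith) (sub_nonneg.2 hx.le)

lemma RSlope.nonneg (h : RSlope f t ν) (L : V →ₗ[ℝ] ℝ) (hb : t < b)
    (hp : ∀ x, t < x → x < b → L (f t) ≤ L (f x)) : 0 ≤ L ν := by
  obtain ⟨x, hx, hlt, heq⟩ := h.exists_gt L hb hp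
  exact nonneg_of_mul_nonneg_right (by linarith) (sub_pos.2 hx)

lemma RSlope.neg (h : RSlope f t ν) (L : V →ₗ[ℝ] ℝ) (hb : t < b)
    (hp : ∀ x, t < x → x < b → L (f x) < L (f t)) : L ν < 0 := by
  have := h.pos (-L) hb fun x h1 h2 => neg_lt_neg (hp x h1 h2)
  exact neg_pos.1 this

lemma LSlope.neg (h : LSlope f t ν) (L : V →ₗ[ℝ] ℝ) (hb : b < t)
    (hp : ∀ x, b < x → x < t → L (f t) < L (f x)) : L ν < 0 := by
  obtain ⟨x, hx, hlt, heq⟩ := h.exists_lt L hb hp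
  have : 0 < (t - x) * -L ν := by linarith
  exact neg_pos.1 (pos_of_mul_pos_right this (sub_nonneg.2 hx.le))

lemma LSlope.nonpos (h : LSlope f t ν) (L : V →ₗ[ℝ] ℝ) (hb : b < t)
    (hp : ∀ x, b < x → x < t → L (f t) ≤ L (f x)) : L ν ≤ 0 := by
  obtain ⟨x, hx, hlt, heq⟩ := h.exists_lt L hb hp
  have : 0 ≤ (t - x) * -L ν := by linarith
  exact neg_nonneg.1 (nonneg_of_mul_nonneg_right this (sub_pos.2 hx))

lemma LSlope.pos (h : LSlope f t ν) (L : V →ₗ[ℝ] ℝ) (hb : b < t)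
    (hp : ∀ x, b < x → x < t → L (f x) < L (f t)) : 0 < L ν := by
  have := h.neg (-L) hb fun x h1 h2 => neg_lt_neg (hp x h1 h2)
  exact neg_neg_iff_pos.1 this

end Slopes

namespace KacMoodyData

variable {I V : Type*} [Fintype I] [DecidableEq I] [AddCommGroup V] [Module ℝ V]
variable {K : KacMoodyData I V} {lam : V} {f : ℝ → V}

namespace WeakLS

lemma exists_rslope (h : K.WeakLS lam f) (t : ℝ) : ∃ ν, RSlope f t ν := by
  rcases lt_trichotomy t 0 with ht | rfl | ht
  · refine ⟨0, ?_⟩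
    filter_upwards [Ioo_mem_nhdsGT ht] with x hx
    rw [h.of_nonpos x hx.2.le, h.of_nonpos t ht.le, smul_zero, add_zero]
  · obtain ⟨ν, -, hν⟩ := h.right_zero
    exact ⟨ν, hν⟩
  rcases lt_or_ge t 1 with ht1 | ht1
  · obtain ⟨-, -, ν, -, -, hν, -⟩ := h.jump t ht ht1
    exact ⟨ν, hν⟩
  · refine ⟨0, ?_⟩
    filter_upwards [self_mem_nhdsWithin] with x hx
    rw [h.of_one_le x (ht1.trans (le_of_lt hx)), h.of_one_le t ht1, smul_zero, add_zero]

lemma exists_lslope (h : K.WeakLS lam f) (t : ℝ) : ∃ ν, LSlope f t ν := by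
  rcases lt_trichotomy t 1 with ht | rfl | ht
  · rcases le_or_gt t 0 with ht0 | ht0
    · refine ⟨0, ?_⟩
      filter_upwards [self_mem_nhdsWithin] with x hx
      rw [h.of_nonpos x ((le_of_lt hx).trans ht0), h.of_nonpos t ht0, smul_zero, add_zero]
    · obtain ⟨ν, -, -, -, hν, -⟩ := h.jump t ht0 ht
      exact ⟨ν, hν⟩
  · obtain ⟨ν, -, hν⟩ := h.left_one
    exact ⟨ν, hν⟩
  · refine ⟨0, ?_⟩
    filter_upwards [Ioo_mem_nhdsLT ht] with x hx
    rw [h.of_one_le x hx.1.le, h.of_one_le t ht.le, smul_zero, add_zero]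

lemma continuous_H (h : K.WeakLS lam f) (i : I) : Continuous (K.H i f) := by
  rw [continuous_iff_continuousAt]
  intro t
  have key : ∀ (ν : V) (s : Set ℝ), (∀ᶠ x in 𝓝[s] t, f x = f t + (x - t) • ν) →
      ContinuousWithinAt (K.H i f) s t := by
    intro ν s hs
    have hc : ContinuousWithinAt (fun x => K.H i f t + (x - t) * K.coroot i ν) s t := by
      fun_prop
    refine hc.congr_of_eventuallyEq ?_ (by simp)
    filter_upwards [hs] with x hx
    rw [H, hx, map_add, map_smul, smul_eq_mul, H]
  obtain ⟨ν, hν⟩ := h.exists_lslope t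
  obtain ⟨ν', hν'⟩ := h.exists_rslope t
  exact continuousAt_iff_continuous_left'_right'.2 ⟨key ν _ hν, key ν' _ hν'⟩

end WeakLS

variable (K) in
/-- The path obtained from `f` by reflecting its part over `[t₀, t₁]`. -/
def bend (i : I) (f : ℝ → V) (t₀ t₁ : ℝ) : ℝ → V := fun t =>
  if t ≤ t₀ then f t
  else if t ≤ t₁ then K.refl i (f t - f t₀) + f t₀
  else f t - (K.H i f t₁ - K.H i f t₀) • K.α i

section Bend

variable (i : I) {t₀ t₁ : ℝ}

lemma bend_left {t : ℝ} (ht : t ≤ t₀) : K.bend i f t₀ t₁ t = f t := if_pos ht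

lemma bend_mid {t : ℝ} (ht : t₀ ≤ t) (ht' : t ≤ t₁) :
    K.bend i f t₀ t₁ t = K.refl i (f t) + (f t₀ - K.refl i (f t₀)) := by
  rcases ht.eq_or_lt with rfl | ht
  · rw [bend_left i le_rfl]
    abel
  · rw [bend, if_neg ht.not_ge, if_pos ht', map_sub]
    abel

lemma bend_right {t : ℝ} (h01 : t₀ < t₁) (ht : t₁ ≤ t) :
    K.bend i f t₀ t₁ t = f t + -((K.H i f t₁ - K.H i f t₀) • K.α i) := by
  rcases ht.eq_or_lt with rfl | ht
  · rw [bend_mid i h01.le le_rfl, refl_apply, refl_apply, H, H]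
    module
  · rw [bend, if_neg (h01.trans ht).not_ge, if_neg ht.not_ge, sub_eq_add_neg]

lemma WeakLS.bend (h : K.WeakLS lam f) (h0 : 0 ≤ t₀) (h01 : t₀ < t₁) (h1 : t₁ ≤ 1)
    (hstart : 0 < t₀ → ∀ ν ∈ K.orbit lam, ∀ ν', LSlope f t₀ ν → RSlope f t₀ ν' →
      K.Jump t₀ ν ν' → K.Jump t₀ ν (K.refl i ν'))
    (hmid : ∀ t, t₀ < t → t < t₁ → ∀ ν ∈ K.orbit lam, ∀ ν', LSlope f t ν → RSlope f t ν' →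
      K.Jump t ν ν' → K.Jump t (K.refl i ν) (K.refl i ν'))
    (hend : t₁ < 1 → ∀ ν ∈ K.orbit lam, ∀ ν', LSlope f t₁ ν → RSlope f t₁ ν' →
      K.Jump t₁ ν ν' → K.Jump t₁ (K.refl i ν) ν') :
    K.WeakLS lam (K.bend i f t₀ t₁) := by
  have hrl : ∀ {t ν}, t < t₀ → RSlope f t ν → RSlope (K.bend i f t₀ t₁) t ν :=
    fun ht hν => hν.map LinearMap.id 0 ht fun x hx => by simpa using bend_left i hx.2
  have hll : ∀ {t ν}, t ≤ t₀ → LSlope f t ν → LSlope (K.bend i f t₀ t₁) t ν := fun {t} ν ht hν =>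
    hν.map LinearMap.id 0 (sub_one_lt t) fun x hx => by simpa using bend_left i (hx.2.trans ht)
  have hrm : ∀ {t ν}, t₀ ≤ t → t < t₁ → RSlope f t ν →
      RSlope (K.bend i f t₀ t₁) t (K.refl i ν) := fun ht ht' hν =>
    hν.map (K.refl i).toLinearMap _ ht' fun x hx => bend_mid i (ht.trans hx.1) hx.2
  have hlm : ∀ {t ν}, t₀ < t → t ≤ t₁ → LSlope f t ν →
      LSlope (K.bend i f t₀ t₁) t (K.refl i ν) := fun ht ht' hν =>
    hν.map (K.refl i).toLinearMap _ ht fun x hx => bend_mid i hx.1 (hx.2.trans ht')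
  have hrr : ∀ {t ν}, t₁ ≤ t → RSlope f t ν → RSlope (K.bend i f t₀ t₁) t ν := fun {t} ν ht hν =>
    hν.map LinearMap.id _ (lt_add_one t) fun x hx => bend_right i h01 (ht.trans hx.1)
  have hlr : ∀ {t ν}, t₁ < t → LSlope f t ν → LSlope (K.bend i f t₀ t₁) t ν := fun ht hν =>
    hν.map LinearMap.id _ ht fun x hx => bend_right i h01 hx.1
  refine ⟨fun t ht => ?_, fun t ht => ?_, ?_, ?_, fun t ht0 ht1 => ?_⟩
  · rw [bend_left i (ht.trans h0), h.of_nonpos t ht]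
  · rw [bend_right i h01 (h1.trans ht), bend_right i h01 h1, h.of_one_le t ht]
  · obtain ⟨ν, hν, hr⟩ := h.right_zero
    rcases h0.eq_or_lt with h0 | h0
    · exact ⟨_, K.refl_mem_orbit i hν, hrm h0.ge (h0.symm ▸ h01) hr⟩
    · exact ⟨ν, hν, hrl h0 hr⟩
  · obtain ⟨ν, hν, hl⟩ := h.left_one
    rcases h1.eq_or_lt with h1 | h1
    · exact ⟨_, K.refl_mem_orbit i hν, hlm (h1 ▸ h01) h1.ge hl⟩
    · exact ⟨ν, hν, hlr h1 hl⟩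
  · obtain ⟨ν, hν, ν', hν', hl, hr, hJ⟩ := h.jump t ht0 ht1
    rcases lt_trichotomy t t₀ with hlt | rfl | hgt
    · exact ⟨ν, hν, ν', hν', hll hlt.le hl, hrl hlt hr, hJ⟩
    · exact ⟨ν, hν, _, K.refl_mem_orbit i hν', hll le_rfl hl, hrm le_rfl h01 hr,
        hstart ht0 ν hν ν' hl hr hJ⟩
    rcases lt_trichotomy t t₁ with hlt | rfl | hgt'
    · exact ⟨_, K.refl_mem_orbit i hν, _, K.refl_mem_orbit i hν', hlm hgt hlt.le hl,
        hrm hgt.le hlt hr, hmid t hgt hlt ν hν ν' hl hr hJ⟩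
    · exact ⟨_, K.refl_mem_orbit i hν, ν', hν', hlm h01 le_rfl hl, hrr le_rfl hr,
        hend ht1 ν hν ν' hl hr hJ⟩
    · exact ⟨ν, hν, ν', hν', hlr hgt' hl, hrr hgt'.le hr, hJ⟩

end Bend

end KacMoodyData

end LSPaper

namespace LSPaper

open Filter Topology

namespace KacMoodyData

variable {I V : Type*} [Fintype I] [DecidableEq I] [AddCommGroup V] [Module ℝ V]
variable {K : KacMoodyData I V} {lam : V} {f : ℝ → V}

lemma exists_first {h : ℝ → ℝ} (hc : Continuous h) {a b c : ℝ}
    (hne : ∃ t ∈ Set.Icc a b, h t = c) :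
    sInf {t | t ∈ Set.Icc a b ∧ h t = c} ∈ Set.Icc a b ∧
      h (sInf {t | t ∈ Set.Icc a b ∧ h t = c}) = c ∧
      ∀ t ∈ Set.Icc a b, h t = c → sInf {t | t ∈ Set.Icc a b ∧ h t = c} ≤ t := by
  have hcl : IsClosed {t | t ∈ Set.Icc a b ∧ h t = c} :=
    isClosed_Icc.inter (isClosed_eq hc continuous_const)
  have hbdd : BddBelow {t | t ∈ Set.Icc a b ∧ h t = c} := ⟨a, fun t ht => ht.1.1⟩
  have := hcl.csInf_mem hne hbdd
  exact ⟨this.1, this.2, fun t ht htc => csInf_le hbdd ⟨ht, htc⟩⟩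

lemma exists_last {h : ℝ → ℝ} (hc : Continuous h) {a b c : ℝ}
    (hne : ∃ t ∈ Set.Icc a b, h t = c) :
    sSup {t | t ∈ Set.Icc a b ∧ h t = c} ∈ Set.Icc a b ∧
      h (sSup {t | t ∈ Set.Icc a b ∧ h t = c}) = c ∧
      ∀ t ∈ Set.Icc a b, h t = c → t ≤ sSup {t | t ∈ Set.Icc a b ∧ h t = c} := by
  have hcl : IsClosed {t | t ∈ Set.Icc a b ∧ h t = c} :=
    isClosed_Icc.inter (isClosed_eq hc continuous_const)
  have hbdd : BddAbove {t | t ∈ Set.Icc a b ∧ h t = c} := ⟨b, fun t ht => ht.1.2⟩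
  have := hcl.csSup_mem hne hbdd
  exact ⟨this.1, this.2, fun t ht htc => le_csSup hbdd ⟨ht, htc⟩⟩

/-- A continuous function attains its minimum on `[a, b]` at a first and at a last point. -/
lemma exists_first_last_min {h : ℝ → ℝ} (hc : Continuous h) {a b : ℝ} (hab : a ≤ b) :
    (∃ z ∈ Set.Icc a b, (∀ t ∈ Set.Icc a b, h z ≤ h t) ∧ ∀ t ∈ Set.Ico a z, h z < h t) ∧
    (∃ z ∈ Set.Icc a b, (∀ t ∈ Set.Icc a b, h z ≤ h t) ∧ ∀ t ∈ Set.Ioc z b, h z < h t) := by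
  obtain ⟨y, hy, hmin⟩ := isCompact_Icc.exists_isMinOn (Set.nonempty_Icc.2 hab) hc.continuousOn
  have hmin : ∀ t ∈ Set.Icc a b, h y ≤ h t := fun t ht => hmin ht
  obtain ⟨h1, h2, h3⟩ := exists_first hc ⟨y, hy, rfl⟩
  obtain ⟨h4, h5, h6⟩ := exists_last hc ⟨y, hy, rfl⟩
  refine ⟨⟨_, h1, fun t ht => h2.trans_le (hmin t ht), fun t ht => ?_⟩,
    ⟨_, h4, fun t ht => h5.trans_le (hmin t ht), fun t ht => ?_⟩⟩
  · have ht' : t ∈ Set.Icc a b := ⟨ht.1, ht.2.le.trans h1.2⟩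
    rw [h2]
    refine (hmin t ht').lt_of_ne fun heq => ?_
    exact ht.2.not_ge (h3 t ht' heq.symm)
  · have ht' : t ∈ Set.Icc a b := ⟨h4.1.trans ht.1.le, ht.2⟩
    rw [h5]
    refine (hmin t ht').lt_of_ne fun heq => ?_
    exact ht.1.not_ge (h6 t ht' heq.symm)

/-- A strict-from-the-left local minimum of `H` inside `(0, 1)` has integral value. -/
lemma exists_int_of_left_min (hlam : lam ∈ K.P) (hf : f ∈ K.B lam) (i : I)
    {a z b : ℝ} (h0 : 0 < z) (h1 : z < 1) (ha : a < z) (hb : z < b)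
    (hl : ∀ x, a < x → x < z → K.H i f z < K.H i f x)
    (hr : ∀ x, z < x → x < b → K.H i f z ≤ K.H i f x) : ∃ n : ℤ, K.H i f z = n := by
  obtain ⟨ν, hν, ν', -, hL, hR, hJ⟩ := (weakLS_of_mem_B hf).jump z h0 h1
  obtain ⟨-, n, hn⟩ := hJ.refl_left_of_neg h0 (K.orbit_subset_P hlam hν)
    (hL.neg (K.coroot i) ha hl) (hR.nonneg (K.coroot i) hb hr)
  obtain ⟨k, hk⟩ := hJ.exists_int i
  obtain ⟨l, hl⟩ := exists_int_of_mem_B hf h0 h1.le hL i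
  refine ⟨l + n - k, ?_⟩
  push_cast
  rw [← hl, ← hn, hk, H]
  ring

lemma exists_int_of_right_min (hlam : lam ∈ K.P) (hf : f ∈ K.B lam) (i : I)
    {a z b : ℝ} (h0 : 0 < z) (h1 : z < 1) (ha : a < z) (hb : z < b)
    (hl : ∀ x, a < x → x < z → K.H i f z ≤ K.H i f x)
    (hr : ∀ x, z < x → x < b → K.H i f z < K.H i f x) : ∃ n : ℤ, K.H i f z = n := by
  obtain ⟨ν, hν, ν', -, hL, hR, hJ⟩ := (weakLS_of_mem_B hf).jump z h0 h1
  obtain ⟨-, n, hn⟩ := hJ.refl_right_of_pos h0 (K.orbit_subset_P hlam hν)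
    (hL.nonpos (K.coroot i) ha hl) (hR.pos (K.coroot i) hb hr)
  obtain ⟨l, hl⟩ := exists_int_of_mem_B hf h0 h1.le hL i
  refine ⟨l + n, ?_⟩
  push_cast
  rw [← hl, ← hn, H]
  ring

lemma exists_int_H_one (hlam : lam ∈ K.P) (hf : f ∈ K.B lam) (i : I) : ∃ n : ℤ, K.H i f 1 = n := by
  obtain ⟨ν, hν, hL⟩ := (weakLS_of_mem_B hf).left_one
  obtain ⟨l, hl⟩ := exists_int_of_mem_B hf one_pos le_rfl hL i
  obtain ⟨k, hk⟩ := K.pairingInt i _ (K.orbit_subset_P hlam hν)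
  refine ⟨l + k, ?_⟩
  push_cast
  rw [← hl, ← hk, H]
  ring

lemma exists_mval_eq (hf : f ∈ K.B lam) (i : I)
    : ∃ t ∈ Set.Icc (0 : ℝ) 1, K.H i f t = K.mval i f := by
  obtain ⟨⟨z, hz, hmin, -⟩, -⟩ :=
    exists_first_last_min ((weakLS_of_mem_B hf).continuous_H i) zero_le_one
  refine ⟨z, hz, le_antisymm (le_csInf ⟨_, z, hz, rfl⟩ ?_)
    (csInf_le ⟨K.H i f z, ?_⟩ ⟨z, hz, rfl⟩)⟩
  · rintro _ ⟨t, ht, rfl⟩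
    exact hmin t ht
  · rintro _ ⟨t, ht, rfl⟩
    exact hmin t ht

lemma mval_le (hf : f ∈ K.B lam) (i : I)
    {t : ℝ} (ht : t ∈ Set.Icc (0 : ℝ) 1) : K.mval i f ≤ K.H i f t := by
  obtain ⟨⟨z, hz, hmin, -⟩, -⟩ :=
    exists_first_last_min ((weakLS_of_mem_B hf).continuous_H i) zero_le_one
  refine csInf_le ⟨K.H i f z, ?_⟩ ⟨t, ht, rfl⟩
  rintro _ ⟨t, ht, rfl⟩
  exact hmin t ht

lemma H_zero (hf : f ∈ K.B lam) (i : I) : K.H i f 0 = 0 := by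
  rw [H, (weakLS_of_mem_B hf).of_nonpos 0 le_rfl, map_zero]

lemma exists_int_mval (hlam : lam ∈ K.P) (hf : f ∈ K.B lam) (i : I) : ∃ n : ℤ, K.mval i f = n := by
  obtain ⟨h1, h2, h3⟩ :=
    exists_first ((weakLS_of_mem_B hf).continuous_H i) (exists_mval_eq hf i)
  set z := sInf {t | t ∈ Set.Icc (0 : ℝ) 1 ∧ K.H i f t = K.mval i f} with hz
  rw [← h2]
  rcases h1.1.eq_or_lt with h0 | h0
  · exact ⟨0, by rw [← h0, H_zero hf]; simp⟩
  rcases h1.2.eq_or_lt with h4 | h4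
  · rw [h4]
    exact exists_int_H_one hlam hf i
  refine exists_int_of_left_min hlam hf i h0 h4 h0 h4 (fun x hx hxz => ?_) fun x hx hx1 => ?_
  · rw [h2]
    have hx1 : x ∈ Set.Icc (0 : ℝ) 1 := ⟨hx.le, (hxz.trans h4).le⟩
    exact (mval_le hf i hx1).lt_of_ne fun heq => hxz.not_ge (h3 x hx1 heq.symm)
  · rw [h2]
    exact mval_le hf i ⟨(h0.trans hx).le, hx1.le⟩

lemma strictAnti_H (hlam : lam ∈ K.P) (hf : f ∈ K.B lam) (i : I)
    {a b : ℝ} {M : ℤ} (h0 : 0 ≤ a) (h1 : b ≤ 1) (ha : K.H i f a = M + 1)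
    (hb : K.H i f b = M) (hM : ∀ t, a < t → t < b → (M : ℝ) < K.H i f t ∧ K.H i f t < M + 1) :
    ∀ x y, a ≤ x → x < y → y ≤ b → K.H i f y < K.H i f x := by
  intro x y hax hxy hyb
  by_contra! hle
  have hlt : ∀ t, a < t → t ≤ b → K.H i f t < M + 1 := fun t hat htb => by
    rcases htb.eq_or_lt with rfl | htb
    · rw [hb]; linarith
    · exact (hM t hat htb).2
  obtain ⟨⟨z, hz, hmin, hfirst⟩, -⟩ :=
    exists_first_last_min ((weakLS_of_mem_B hf).continuous_H i) (hax.trans hxy.le)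
  have hzx := hmin x ⟨hax, hxy.le⟩
  have hzy : z < y := by
    refine hz.2.lt_of_ne ?_
    rintro rfl
    exact (hfirst x ⟨hax, hxy⟩).not_ge hle
  have haz : a < z := by
    refine hz.1.lt_of_ne ?_
    rintro rfl
    have := hlt y hzy hyb
    linarith
  obtain ⟨n, hn⟩ := exists_int_of_left_min hlam hf i (h0.trans_lt haz)
    ((hzy.trans_le hyb).trans_le h1) haz hzy (fun t h1 h2 => hfirst t ⟨h1.le, h2⟩)
    (fun t h1 h2 => hmin t ⟨(haz.trans h1).le, h2.le⟩)
  have := hM z haz (hzy.trans_le hyb)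
  rw [hn] at this
  have h2 : M < n := by exact_mod_cast this.1
  have h3 : n < M + 1 := by exact_mod_cast this.2
  lia

lemma strictMono_H (hlam : lam ∈ K.P) (hf : f ∈ K.B lam) (i : I)
    {a b : ℝ} {M : ℤ} (h0 : 0 ≤ a) (h1 : b ≤ 1) (ha : K.H i f a = M)
    (hb : K.H i f b = M + 1) (hM : ∀ t, a < t → t < b → (M : ℝ) < K.H i f t ∧ K.H i f t < M + 1) :
    ∀ x y, a ≤ x → x < y → y ≤ b → K.H i f x < K.H i f y := by
  intro x y hax hxy hyb
  by_contra! hle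
  have hlt : ∀ t, a ≤ t → t < b → K.H i f t < M + 1 := fun t hat htb => by
    rcases hat.eq_or_lt with rfl | hat
    · rw [ha]; linarith
    · exact (hM t hat htb).2
  obtain ⟨-, z, hz, hmin, hlast⟩ :=
    exists_first_last_min ((weakLS_of_mem_B hf).continuous_H i) (hxy.le.trans hyb)
  have hzy := hmin y ⟨hxy.le, hyb⟩
  have hxz : x < z := by
    refine hz.1.lt_of_ne ?_
    rintro rfl
    exact (hlast y ⟨hxy, hyb⟩).not_ge hle
  have hzb : z < b := by
    refine hz.2.lt_of_ne ?_
    rintro rfl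
    have := hlt x hax hxz
    linarith
  obtain ⟨n, hn⟩ := exists_int_of_right_min hlam hf i (h0.trans_lt (hax.trans_lt hxz))
    (hzb.trans_le h1) hxz hzb (fun t h1 h2 => hmin t ⟨h1.le, (h2.trans hzb).le⟩)
    (fun t h1 h2 => hlast t ⟨h1, h2.le⟩)
  have := hM z (hax.trans_lt hxz) hzb
  rw [hn] at this
  have h2 : M < n := by exact_mod_cast this.1
  have h3 : n < M + 1 := by exact_mod_cast this.2
  lia

lemma eraw_mem_B (hlam : lam ∈ K.P) (hf : f ∈ K.B lam) (i : I)
    (hne : K.mval i f ≠ 0) : K.eraw i f ∈ K.B lam := by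
  have hW := weakLS_of_mem_B hf
  have hc := hW.continuous_H i
  obtain ⟨M, hM⟩ := exists_int_mval hlam hf i
  obtain ⟨h1, h2, h3⟩ := exists_first hc (exists_mval_eq hf i)
  set b := sInf {t | t ∈ Set.Icc (0 : ℝ) 1 ∧ K.H i f t = K.mval i f} with hb
  have hM0 : (M : ℝ) + 1 ≤ 0 := by
    have h4 := mval_le hf i (t := 0) (by simp)
    rw [H_zero hf, hM] at h4
    have h5 : M ≠ 0 := by
      rintro rfl
      exact hne (by simpa using hM)
    have h6 : M ≤ 0 := by exact_mod_cast h4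
    have : M + 1 ≤ 0 := by lia
    exact_mod_cast this
  obtain ⟨h4, h5, h6⟩ := exists_last hc (a := 0) (b := b) (c := K.mval i f + 1) (by
    have := intermediate_value_Icc' h1.1 hc.continuousOn
    exact this ⟨by rw [h2]; linarith, by rw [H_zero hf, hM]; exact hM0⟩)
  set a := sSup {t | t ∈ Set.Icc (0 : ℝ) b ∧ K.H i f t = K.mval i f + 1} with ha
  have hab : a < b := by
    refine h4.2.lt_of_ne fun heq => ?_
    rw [heq, h2] at h5
    linarith
  have hbd : ∀ t, a < t → t < b → (M : ℝ) < K.H i f t ∧ K.H i f t < M + 1 := by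
    intro t hat htb
    have ht0 : 0 ≤ t := h4.1.trans hat.le
    have ht : t ∈ Set.Icc (0 : ℝ) 1 := ⟨ht0, htb.le.trans h1.2⟩
    rw [← hM]
    refine ⟨(mval_le hf i ht).lt_of_ne fun heq => htb.not_ge (h3 t ht heq.symm), ?_⟩
    by_contra! hge
    obtain ⟨y, hy, hy'⟩ := intermediate_value_Icc' htb.le hc.continuousOn
      (show K.mval i f + 1 ∈ Set.Icc _ _ from ⟨by rw [h2]; linarith, hge⟩)
    exact (hat.trans_le hy.1).not_ge (h6 y ⟨ht0.trans hy.1, hy.2⟩ hy')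
  have hanti := strictAnti_H hlam hf i h4.1 h1.2 (by rw [h5, hM]) (by rw [h2, hM]) hbd
  have hraw : K.eraw i f = K.bend i f a b := by
    funext t
    simp only [eraw, bend, ← hb, ← ha, h2, h5]
    congr 2
    module
  rw [hraw]
  have hLneg : ∀ t, a < t → t ≤ b → ∀ ν, LSlope f t ν → K.coroot i ν < 0 :=
    fun t hat htb ν hν => hν.neg (K.coroot i) hat fun x h1 h2 => hanti x t h1.le h2 htb
  have hRneg : ∀ t, a ≤ t → t < b → ∀ ν, RSlope f t ν → K.coroot i ν < 0 :=
    fun t hat htb ν hν => hν.neg (K.coroot i) htb fun x h1 h2 => hanti t x hat h1 h2.le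
  refine (hW.bend i h4.1 hab h1.2 ?_ ?_ ?_).mem_B hlam
  · intro ha0 ν hν ν' hL hR hJ
    obtain ⟨n, hn⟩ := exists_int_of_mem_B hf ha0 (h4.2.trans h1.2) hL i
    obtain ⟨k, hk⟩ := hJ.exists_int i
    have hP := K.orbit_subset_P hlam hν
    refine hJ.tail (coverStep_refl ha0 (hJ.mem_P hP) (hRneg a le_rfl hab ν' hR)
      ⟨M + 1 - n + k, ?_⟩)
    rw [hk]
    push_cast
    rw [← hn, ← hM, ← h5, H]
    ring
  · intro t hat htb ν hν ν' hL hR hJ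
    exact hJ.refl_of_neg (h4.1.trans_lt hat) (K.orbit_subset_P hlam hν) (hLneg t hat htb.le ν hL)
      (hRneg t hat.le htb ν' hR)
  · intro hb1 ν hν ν' hL hR hJ
    refine (hJ.refl_left_of_neg (h4.1.trans_lt hab) (K.orbit_subset_P hlam hν)
      (hLneg b hab le_rfl ν hL) (hR.nonneg (K.coroot i) hb1 fun x hx hx1 => ?_)).1
    exact h2.trans_le (mval_le hf i ⟨h1.1.trans hx.le, hx1.le⟩)

lemma fraw_mem_B (hlam : lam ∈ K.P) (hf : f ∈ K.B lam) (i : I)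
    (hne : K.H i f 1 - K.mval i f ≠ 0) : K.fraw i f ∈ K.B lam := by
  have hW := weakLS_of_mem_B hf
  have hc := hW.continuous_H i
  obtain ⟨M, hM⟩ := exists_int_mval hlam hf i
  obtain ⟨N, hN⟩ := exists_int_H_one hlam hf i
  obtain ⟨h1, h2, h3⟩ := exists_last hc (exists_mval_eq hf i)
  set a := sSup {t | t ∈ Set.Icc (0 : ℝ) 1 ∧ K.H i f t = K.mval i f} with ha
  have hM1 : K.mval i f + 1 ≤ K.H i f 1 := by
    have h4 := mval_le hf i (t := 1) (by simp)
    rw [hM, hN] at h4 hne ⊢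
    have h5 : N ≠ M := by
      rintro rfl
      exact hne (sub_self _)
    have h6 : M ≤ N := by exact_mod_cast h4
    have : M + 1 ≤ N := by lia
    exact_mod_cast this
  obtain ⟨h4, h5, h6⟩ := exists_first hc (a := a) (b := 1) (c := K.mval i f + 1) (by
    have := intermediate_value_Icc h1.2 hc.continuousOn
    exact this ⟨by rw [h2]; linarith, hM1⟩)
  set b := sInf {t | t ∈ Set.Icc a 1 ∧ K.H i f t = K.mval i f + 1} with hb
  have hab : a < b := by
    refine h4.1.lt_of_ne fun heq => ?_
    rw [← heq, h2] at h5
    linarith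
  have hbd : ∀ t, a < t → t < b → (M : ℝ) < K.H i f t ∧ K.H i f t < M + 1 := by
    intro t hat htb
    have ht1 : t ≤ 1 := htb.le.trans h4.2
    have ht : t ∈ Set.Icc (0 : ℝ) 1 := ⟨h1.1.trans hat.le, ht1⟩
    rw [← hM]
    refine ⟨(mval_le hf i ht).lt_of_ne fun heq => hat.not_ge (h3 t ht heq.symm), ?_⟩
    by_contra! hge
    obtain ⟨y, hy, hy'⟩ := intermediate_value_Icc hat.le hc.continuousOn
      (show K.mval i f + 1 ∈ Set.Icc _ _ from ⟨by rw [h2]; linarith, hge⟩)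
    exact (hy.2.trans_lt htb).not_ge (h6 y ⟨hy.1, hy.2.trans ht1⟩ hy')
  have hmono := strictMono_H hlam hf i h1.1 h4.2 (by rw [h2, hM]) (by rw [h5, hM]) hbd
  have hraw : K.fraw i f = K.bend i f a b := by
    funext t
    simp only [fraw, bend, ← ha, ← hb, h2, h5]
    congr 2
    module
  rw [hraw]
  have hLpos : ∀ t, a < t → t ≤ b → ∀ ν, LSlope f t ν → 0 < K.coroot i ν :=
    fun t hat htb ν hν => hν.pos (K.coroot i) hat fun x h1 h2 => hmono x t h1.le h2 htb
  have hRpos : ∀ t, a ≤ t → t < b → ∀ ν, RSlope f t ν → 0 < K.coroot i ν :=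
    fun t hat htb ν hν => hν.pos (K.coroot i) htb fun x h1 h2 => hmono t x hat h1 h2.le
  refine (hW.bend i h1.1 hab h4.2 ?_ ?_ ?_).mem_B hlam
  · intro ha0 ν hν ν' hL hR hJ
    refine (hJ.refl_right_of_pos ha0 (K.orbit_subset_P hlam hν)
      (hL.nonpos (K.coroot i) ha0 fun x hx hxa => ?_) (hRpos a le_rfl hab ν' hR)).1
    exact h2.trans_le (mval_le hf i ⟨hx.le, hxa.le.trans h1.2⟩)
  · intro t hat htb ν hν ν' hL hR hJ
    exact hJ.refl_of_pos (h1.1.trans_lt hat) (K.orbit_subset_P hlam hν) (hLpos t hat htb.le ν hL)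
      (hRpos t hat.le htb ν' hR)
  · intro hb1 ν hν ν' hL hR hJ
    have hb0 := h1.1.trans_lt hab
    obtain ⟨n, hn⟩ := exists_int_of_mem_B hf hb0 h4.2 hL i
    refine hJ.head (coverStep_refl' hb0 (K.orbit_subset_P hlam hν) (hLpos b hab le_rfl ν hL)
      ⟨M + 1 - n, ?_⟩)
    push_cast
    rw [← hn, ← hM, ← h5, H]
    ring

end KacMoodyData

end LSPaper

namespace LSPaper

open Filter Topology

variable {V : Type*} [AddCommGroup V] [Module ℝ V]

lemma clamp01_of_mem {t : ℝ} (h0 : 0 ≤ t) (h1 : t ≤ 1) : clamp01 t = t := by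
  rw [clamp01, min_eq_right h1, max_eq_right h0]

lemma clamp01_of_nonpos {t : ℝ} (ht : t ≤ 0) : clamp01 t = 0 :=
  max_eq_left ((min_le_right _ _).trans ht)

lemma clamp01_of_one_le {t : ℝ} (ht : 1 ≤ t) : clamp01 t = 1 := by
  rw [clamp01, min_eq_left ht, max_eq_right zero_le_one]

/-- The `k`-th piece (counted from `0`) of the subdivision of `f` into `m` pieces. -/
def piece (m k : ℕ) (f : ℝ → V) : ℝ → V := fun t => f ((clamp01 t + k) / m) - f ((k : ℝ) / m)

variable {m k : ℕ} {f : ℝ → V} {t : ℝ} {ν : V}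

lemma RSlope.piece (hm : 0 < m) (h0 : 0 ≤ t) (h1 : t < 1) (h : RSlope f ((t + k) / m) ν) :
    RSlope (LSPaper.piece m k f) t ((m : ℝ)⁻¹ • ν) := by
  have hm' : (0 : ℝ) < m := by exact_mod_cast hm
  have htend : Tendsto (fun x : ℝ => (x + k) / m) (𝓝[>] t) (𝓝[>] ((t + k) / m)) := by
    refine tendsto_nhdsWithin_iff.2 ⟨Continuous.tendsto' (by fun_prop) _ _ rfl |>.mono_left
      nhdsWithin_le_nhds, ?_⟩
    filter_upwards [self_mem_nhdsWithin] with x hx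
    exact div_lt_div_of_pos_right (add_lt_add_left hx _) hm'
  filter_upwards [htend.eventually h, Ioo_mem_nhdsGT h1] with x hx hx1
  rw [LSPaper.piece, LSPaper.piece, clamp01_of_mem h0 h1.le,
    clamp01_of_mem (h0.trans hx1.1.le) hx1.2.le, hx]
  match_scalars <;> field_simp
  ring

lemma LSlope.piece (hm : 0 < m) (h0 : 0 < t) (h1 : t ≤ 1) (h : LSlope f ((t + k) / m) ν) :
    LSlope (LSPaper.piece m k f) t ((m : ℝ)⁻¹ • ν) := by
  have hm' : (0 : ℝ) < m := by exact_mod_cast hm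
  have htend : Tendsto (fun x : ℝ => (x + k) / m) (𝓝[<] t) (𝓝[<] ((t + k) / m)) := by
    refine tendsto_nhdsWithin_iff.2 ⟨Continuous.tendsto' (by fun_prop) _ _ rfl |>.mono_left
      nhdsWithin_le_nhds, ?_⟩
    filter_upwards [self_mem_nhdsWithin] with x hx
    exact div_lt_div_of_pos_right (add_lt_add_left hx _) hm'
  filter_upwards [htend.eventually h, Ioo_mem_nhdsLT h0] with x hx hx1
  rw [LSPaper.piece, LSPaper.piece, clamp01_of_mem h0.le h1,
    clamp01_of_mem hx1.1.le (hx1.2.le.trans h1), hx]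
  match_scalars <;> field_simp
  ring

lemma subdiv_eq (m : ℕ) (f : ℝ → V) : subdiv m f = List.ofFn fun k : Fin m => piece m k f := rfl

lemma length_subdiv (m : ℕ) (f : ℝ → V) : (subdiv m f).length = m := List.length_ofFn

lemma sum_take_subdiv (hf : f 0 = 0) {j : ℕ} (hj : j ≤ m) :
    (((subdiv m f).take j).map fun g => g 1).sum = f ((j : ℝ) / m) := by
  induction j with
  | zero => simp [hf]
  | succ j ih =>
    have hlt : j < (subdiv m f).length := by rw [length_subdiv]; exact hj
    rw [List.take_add_one, List.getElem?_eq_getElem hlt, List.map_append, List.sum_append,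
      ih (Nat.le_of_succ_le hj)]
    simp [subdiv, clamp01_of_one_le, add_comm]

lemma getD_subdiv {j : ℕ} (hj : j < m) : (subdiv m f).getD j 0 = piece m j f := by
  rw [List.getD_eq_getElem _ _ (by rwa [length_subdiv])]
  simp [subdiv_eq]

lemma concatList_subdiv (hm : 0 < m) (h0 : ∀ t ≤ 0, f t = 0) (h1 : ∀ t, 1 ≤ t → f t = f 1) :
    concatList (subdiv m f) = f := by
  funext t
  have hm' : (0 : ℝ) < m := by exact_mod_cast hm
  obtain ⟨k, hk⟩ : ∃ k : ℕ, max 1 (min m ⌈(m : ℝ) * t⌉.toNat) = k + 1 :=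
    Nat.exists_eq_add_of_le' (le_max_left _ _)
  have hkm : k < m := by omega
  simp only [concatList, length_subdiv, hk, Nat.add_sub_cancel]
  rw [sum_take_subdiv (h0 0 le_rfl) hkm.le, getD_subdiv hkm, piece]
  push_cast
  rw [add_sub_cancel, add_sub_cancel_right]
  rcases le_or_gt t 0 with ht | ht
  · have h : (m : ℝ) * t ≤ 0 := mul_nonpos_of_nonneg_of_nonpos hm'.le ht
    have hc : ⌈(m : ℝ) * t⌉ ≤ 0 := Int.ceil_le.2 (by simpa using h)
    obtain rfl : k = 0 := by omega
    rw [clamp01_of_nonpos (by simpa using h), h0 t ht]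
    simp [h0]
  rcases le_or_gt t 1 with ht1 | ht1
  · have hpos : 0 < (m : ℝ) * t := mul_pos hm' ht
    have hc0 : 0 < ⌈(m : ℝ) * t⌉ := Int.ceil_pos.2 hpos
    have hcm : ⌈(m : ℝ) * t⌉ ≤ m := Int.ceil_le.2 (by
      rw [Int.cast_natCast]; exact mul_le_of_le_one_right hm'.le ht1)
    have hck : ⌈(m : ℝ) * t⌉ = k + 1 := by omega
    obtain ⟨hl, hr⟩ := Int.ceil_eq_iff.1 hck
    push_cast at hl hr
    rw [clamp01_of_mem (by linarith) (by linarith), sub_add_cancel, mul_div_cancel_left₀ _ hm'.ne']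
  · have hlt : (m : ℝ) < m * t := lt_mul_of_one_lt_right hm' ht1
    have hcm : (m : ℤ) < ⌈(m : ℝ) * t⌉ := Int.lt_ceil.2 (by rwa [Int.cast_natCast])
    have hk1 : m = k + 1 := by omega
    have hk2 : (m : ℝ) = k + 1 := by exact_mod_cast hk1
    rw [clamp01_of_one_le (by linarith), h1 t ht1.le, add_comm 1, ← hk2, div_self hm'.ne']

namespace KacMoodyData

variable {I : Type*} [Fintype I] [DecidableEq I]
variable {K : KacMoodyData I V} {μ : V}

lemma WeakLS.piece (hμ : μ ∈ K.P) (hm : 0 < m) (hk : k < m) (h : K.WeakLS ((m : ℝ) • μ) f) :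
    K.WeakLS μ (LSPaper.piece m k f) := by
  have hm' : (0 : ℝ) < m := by exact_mod_cast hm
  have hk' : (k : ℝ) + 1 ≤ m := by exact_mod_cast hk
  have horb : ∀ ν ∈ K.orbit ((m : ℝ) • μ), (m : ℝ)⁻¹ • ν ∈ K.orbit μ := fun ν hν => by
    simpa [inv_smul_smul₀ hm'.ne'] using K.smul_mem_orbit (m : ℝ)⁻¹ hν
  refine ⟨fun t ht => ?_, fun t ht => ?_, ?_, ?_, fun t h0 h1 => ?_⟩
  · simp [LSPaper.piece, clamp01_of_nonpos ht]
  · rw [LSPaper.piece, LSPaper.piece, clamp01_of_one_le ht, clamp01_of_one_le le_rfl]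
  · have key : ∃ ν ∈ K.orbit ((m : ℝ) • μ), RSlope f ((0 + k) / m) ν := by
      rcases Nat.eq_zero_or_pos k with rfl | hk0
      · simpa using h.right_zero
      · have hk0' : (0 : ℝ) < k := by exact_mod_cast hk0
        obtain ⟨-, -, ν, hν, -, hR, -⟩ := h.jump ((0 + k) / m) (by positivity)
          ((div_lt_one hm').2 (by linarith))
        exact ⟨ν, hν, hR⟩
    obtain ⟨ν, hν, hR⟩ := key
    exact ⟨_, horb ν hν, hR.piece hm le_rfl one_pos⟩
  · have key : ∃ ν ∈ K.orbit ((m : ℝ) • μ), LSlope f ((1 + k) / m) ν := by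
      rcases hk'.eq_or_lt with hkm | hkm
      · rw [add_comm, hkm, div_self hm'.ne']
        exact h.left_one
      · obtain ⟨ν, hν, -, -, hL, -⟩ := h.jump ((1 + k) / m) (by positivity)
          ((div_lt_one hm').2 (by linarith))
        exact ⟨ν, hν, hL⟩
    obtain ⟨ν, hν, hL⟩ := key
    exact ⟨_, horb ν hν, hL.piece hm one_pos le_rfl⟩
  · obtain ⟨ν, hν, ν', hν', hL, hR, hJ⟩ := h.jump ((t + k) / m) (by positivity)
      ((div_lt_one hm').2 (by linarith))
    have ht : (m : ℝ) * ((t + k) / m) - k = t := by field_simp; ring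
    have hJ' := hJ.inv_smul hm (by rwa [ht]) (K.orbit_subset_P hμ (horb ν hν))
    rw [ht] at hJ'
    exact ⟨_, horb ν hν, _, horb ν' hν', hL.piece hm h0 h1.le, hR.piece hm h0.le h1, hJ'⟩

lemma subdiv_mem_B (hμ : μ ∈ K.P) (hm : 0 < m) (hf : f ∈ K.B ((m : ℝ) • μ)) {g : ℝ → V}
    (hg : g ∈ subdiv m f) : g ∈ K.B μ := by
  rw [subdiv_eq, List.mem_ofFn] at hg
  obtain ⟨k, rfl⟩ := hg
  exact ((weakLS_of_mem_B hf).piece hμ hm k.2).mem_B hμ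

lemma concatList_subdiv_of_mem_B (hm : 0 < m) (hf : f ∈ K.B ((m : ℝ) • μ)) :
    concatList (subdiv m f) = f :=
  have h := weakLS_of_mem_B hf
  concatList_subdiv hm h.of_nonpos h.of_one_le

end KacMoodyData

end LSPaper

open LSPaper in
theorem statement10 {I V : Type*} [Fintype I] [DecidableEq I] [AddCommGroup V] [Module ℝ V]
    (K : KacMoodyData I V) (μ : V) (hμ : μ ∈ K.P)
    (m : ℕ) (hm : 1 ≤ m) (f : ℝ → V) (hf : f ∈ K.B ((m : ℝ) • μ)) :
    (∀ g ∈ subdiv m f, g ∈ K.B μ) ∧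
    f = concatList (subdiv m f) ∧
    K.B ((m : ℝ) • μ) ⊆ K.ConcatSet μ m ∧
    (∀ i : I, ∀ g, K.eop i f = some g → g ∈ K.B ((m : ℝ) • μ)) ∧
    (∀ i : I, ∀ g, K.fop i f = some g → g ∈ K.B ((m : ℝ) • μ)) := by
  have hmμ : (m : ℝ) • μ ∈ K.P := by
    rw [Nat.cast_smul_eq_nsmul ℝ]
    exact K.P.nsmul_mem hμ m
  refine ⟨fun g hg => KacMoodyData.subdiv_mem_B hμ hm hf hg,
    (KacMoodyData.concatList_subdiv_of_mem_B hm hf).symm, fun g hg => ⟨subdiv m g,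
    length_subdiv m g, fun _ h => KacMoodyData.subdiv_mem_B hμ hm hg h,
    (KacMoodyData.concatList_subdiv_of_mem_B hm hg).symm⟩, fun i g hg => ?_, fun i g hg => ?_⟩
  · rw [KacMoodyData.eop] at hg
    split_ifs at hg with hne
    exact Option.some.inj hg ▸ KacMoodyData.eraw_mem_B hmμ hf i hne
  · rw [KacMoodyData.fop] at hg
    split_ifs at hg with hne
    exact Option.some.inj hg ▸ KacMoodyData.fraw_mem_B hmμ hf i hne
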